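/- arXiv:math/0607706 — 3 statements merged into one kernel-verified Lean document; each statement's English description precedes it below -/
import Mathlib

section
/- Let (φ_ε)_{ε∈(0,1]}, (ω_ε)_{ε∈(0,1]} ∈ M_Φ(Ω×ℝ^p) with (φ_ε − ω_ε)_ε negligible in S^1_hg(Ω×ℝ^p∖0). Then for every compact K ⊆ Ω and every q ∈ ℕ, sup_{y∈K, ξ≠0} |ξ|^{−1} |e^{iφ_ε(y,ξ)} − e^{iω_ε(y,ξ)}| = O(ε^q) as ε→0; moreover the net (e^{iφ_ε} − e^{iω_ε})_ε is negligible in S^1_{0,1}(Ω×(ℝ^p∖0)): for every compact K ⊆ Ω×(ℝ^p∖0), all multi-indices α, β and every q ∈ ℕ, sup_{(y,ξ)∈K^c} ⟨ξ⟩^{−1−|β|} |∂^α_ξ ∂^β_y (e^{iφ_ε} − e^{iω_ε})(y,ξ)| = O(ε^q) as ε→0, where K^c := {(y,tξ): (y,ξ)∈K, t≥1}. -/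
open MeasureTheory Set
open scoped BigOperators Topology Real

noncomputable section

/-- `Euc d` is `d`-dimensional Euclidean space. -/
abbrev Euc (d : ℕ) : Type := EuclideanSpace ℝ (Fin d)

/-- Directional derivative of `f` in direction `v`. -/
def dirD {E F : Type*} [NormedAddCommGroup E] [NormedSpace ℝ E]
    [NormedAddCommGroup F] [NormedSpace ℝ F] (v : E) (f : E → F) : E → F :=
  fun x => fderiv ℝ f x v

/-- Iterated directional derivatives along a list of directions. -/
def dirDs {E F : Type*} [NormedAddCommGroup E] [NormedSpace ℝ E]
    [NormedAddCommGroup F] [NormedSpace ℝ F] (L : List E) (f : E → F) : E → F :=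
  L.foldr dirD f

/-- ⟨ξ⟩ = (1+|ξ|²)^{1/2}. -/
def jb {d : ℕ} (ξ : Euc d) : ℝ := Real.sqrt (1 + ‖ξ‖ ^ 2)

/-- Basis direction in the first (`y`) block. -/
def eY {n p : ℕ} (k : Fin n) : Euc n × Euc p := (EuclideanSpace.single k 1, 0)

/-- Basis direction in the second (`ξ`) block. -/
def eXi {n p : ℕ} (j : Fin p) : Euc n × Euc p := (0, EuclideanSpace.single j 1)

def eX3 {q n p : ℕ} (i : Fin q) : Euc q × Euc n × Euc p := (EuclideanSpace.single i 1, 0, 0)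
def eY3 {q n p : ℕ} (k : Fin n) : Euc q × Euc n × Euc p := (0, EuclideanSpace.single k 1, 0)
def eXi3 {q n p : ℕ} (j : Fin p) : Euc q × Euc n × Euc p := (0, 0, EuclideanSpace.single j 1)

/-- basis directions of `Euc d` indexed by a list of coordinates -/
def basisL {d : ℕ} (L : List (Fin d)) : List (Euc d) :=
  L.map (fun i => EuclideanSpace.single i 1)

/-- |∇_{y,ξ}φ|² as a sum of squares of partial derivatives. -/
def gradSq {n p : ℕ} (φ : Euc n × Euc p → ℝ) (z : Euc n × Euc p) : ℝ :=
  (∑ k : Fin n, (dirD (eY k) φ z) ^ 2) + ∑ j : Fin p, (dirD (eXi j) φ z) ^ 2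

/-- |∇_ξ φ|². -/
def gradXiSq {n p : ℕ} (φ : Euc n × Euc p → ℝ) (z : Euc n × Euc p) : ℝ :=
  ∑ j : Fin p, (dirD (eXi j) φ z) ^ 2

/-- ∇_y φ as a vector in `Euc n`. -/
def gradY {n p : ℕ} (φ : Euc n × Euc p → ℝ) (z : Euc n × Euc p) : Euc n :=
  (EuclideanSpace.equiv (Fin n) ℝ).symm (fun k => dirD (eY k) φ z)

/-- |∇_{y,ξ}φ|² in the three-block setting (gradient w.r.t. `(y,ξ)` only). -/
def gradSq3 {q n p : ℕ} (φ : Euc q × Euc n × Euc p → ℝ) (z : Euc q × Euc n × Euc p) : ℝ :=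
  (∑ k : Fin n, (dirD (eY3 k) φ z) ^ 2) + ∑ j : Fin p, (dirD (eXi3 j) φ z) ^ 2

/-- slow scale net -/
def SlowScale (s : ℝ → ℝ) : Prop :=
  (∀ ε ∈ Set.Ioc (0:ℝ) 1, 0 < s ε) ∧
  ∀ q : ℕ, ∃ c > 0, ∀ ε ∈ Set.Ioc (0:ℝ) 1, s ε ^ q ≤ c / ε

/-- Moderate net in S^m_{ρ,δ}(Ω×ℝ^p): smoothness, membership, moderate bounds. -/
def SymbModerate {n p : ℕ} (Ω : Set (Euc n)) (m ρ δ : ℝ)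
    (a : ℝ → Euc n × Euc p → ℂ) : Prop :=
  (∀ ε ∈ Set.Ioc (0:ℝ) 1, ContDiffOn ℝ (⊤ : ℕ∞) (a ε) (Ω ×ˢ (univ : Set (Euc p)))) ∧
  (∀ ε ∈ Set.Ioc (0:ℝ) 1, ∀ K ⊆ Ω, IsCompact K → ∀ (α : List (Fin p)) (β : List (Fin n)),
    ∃ C : ℝ, ∀ y ∈ K, ∀ ξ : Euc p,
      jb ξ ^ (-m + ρ * (α.length : ℝ) - δ * (β.length : ℝ)) *
        ‖dirDs (α.map eXi ++ β.map eY) (a ε) (y, ξ)‖ ≤ C) ∧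
  ∀ K ⊆ Ω, IsCompact K → ∀ (α : List (Fin p)) (β : List (Fin n)),
    ∃ N : ℕ, ∃ C > 0, ∃ η ∈ Set.Ioc (0:ℝ) 1, ∀ ε ∈ Set.Ioc (0:ℝ) η, ∀ y ∈ K, ∀ ξ : Euc p,
      jb ξ ^ (-m + ρ * (α.length : ℝ) - δ * (β.length : ℝ)) *
        ‖dirDs (α.map eXi ++ β.map eY) (a ε) (y, ξ)‖ ≤ C * ε ^ (-(N : ℤ))

/-- Negligible net in S^m_{ρ,δ}(Ω×ℝ^p). -/
def SymbNegligible {n p : ℕ} (Ω : Set (Euc n)) (m ρ δ : ℝ)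
    (a : ℝ → Euc n × Euc p → ℂ) : Prop :=
  (∀ ε ∈ Set.Ioc (0:ℝ) 1, ContDiffOn ℝ (⊤ : ℕ∞) (a ε) (Ω ×ˢ (univ : Set (Euc p)))) ∧
  (∀ ε ∈ Set.Ioc (0:ℝ) 1, ∀ K ⊆ Ω, IsCompact K → ∀ (α : List (Fin p)) (β : List (Fin n)),
    ∃ C : ℝ, ∀ y ∈ K, ∀ ξ : Euc p,
      jb ξ ^ (-m + ρ * (α.length : ℝ) - δ * (β.length : ℝ)) *
        ‖dirDs (α.map eXi ++ β.map eY) (a ε) (y, ξ)‖ ≤ C) ∧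
  ∀ K ⊆ Ω, IsCompact K → ∀ (α : List (Fin p)) (β : List (Fin n)), ∀ q : ℕ,
    ∃ C > 0, ∃ η ∈ Set.Ioc (0:ℝ) 1, ∀ ε ∈ Set.Ioc (0:ℝ) η, ∀ y ∈ K, ∀ ξ : Euc p,
      jb ξ ^ (-m + ρ * (α.length : ℝ) - δ * (β.length : ℝ)) *
        ‖dirDs (α.map eXi ++ β.map eY) (a ε) (y, ξ)‖ ≤ C * ε ^ q

/-- Regular net in S^m_{ρ,δ}(Ω×ℝ^p): one N works for all derivatives on each compact set. -/
def SymbRegular {n p : ℕ} (Ω : Set (Euc n)) (m ρ δ : ℝ)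
    (a : ℝ → Euc n × Euc p → ℂ) : Prop :=
  (∀ ε ∈ Set.Ioc (0:ℝ) 1, ContDiffOn ℝ (⊤ : ℕ∞) (a ε) (Ω ×ˢ (univ : Set (Euc p)))) ∧
  (∀ ε ∈ Set.Ioc (0:ℝ) 1, ∀ K ⊆ Ω, IsCompact K → ∀ (α : List (Fin p)) (β : List (Fin n)),
    ∃ C : ℝ, ∀ y ∈ K, ∀ ξ : Euc p,
      jb ξ ^ (-m + ρ * (α.length : ℝ) - δ * (β.length : ℝ)) *
        ‖dirDs (α.map eXi ++ β.map eY) (a ε) (y, ξ)‖ ≤ C) ∧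
  ∀ K ⊆ Ω, IsCompact K → ∃ N : ℕ, ∀ (α : List (Fin p)) (β : List (Fin n)),
    ∃ C > 0, ∃ η ∈ Set.Ioc (0:ℝ) 1, ∀ ε ∈ Set.Ioc (0:ℝ) η, ∀ y ∈ K, ∀ ξ : Euc p,
      jb ξ ^ (-m + ρ * (α.length : ℝ) - δ * (β.length : ℝ)) *
        ‖dirDs (α.map eXi ++ β.map eY) (a ε) (y, ξ)‖ ≤ C * ε ^ (-(N : ℤ))

/-- Moderate net in S^m_hg(Ω×ℝ^p∖0) (F-valued, positively homogeneous symbols). -/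
def HgModerate {n p : ℕ} {F : Type*} [NormedAddCommGroup F] [NormedSpace ℝ F]
    (Ω : Set (Euc n)) (m : ℝ) (φ : ℝ → Euc n × Euc p → F) : Prop :=
  ∀ K ⊆ Ω, IsCompact K → ∀ (α : List (Fin p)) (β : List (Fin n)),
    ∃ N : ℕ, ∃ C > 0, ∃ η ∈ Set.Ioc (0:ℝ) 1, ∀ ε ∈ Set.Ioc (0:ℝ) η, ∀ y ∈ K,
      ∀ ξ : Euc p, ξ ≠ 0 →
      ‖ξ‖ ^ (-m + (α.length : ℝ)) *
        ‖dirDs (α.map eXi ++ β.map eY) (φ ε) (y, ξ)‖ ≤ C * ε ^ (-(N : ℤ))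

/-- Negligible net in S^m_hg(Ω×ℝ^p∖0). -/
def HgNegligible {n p : ℕ} {F : Type*} [NormedAddCommGroup F] [NormedSpace ℝ F]
    (Ω : Set (Euc n)) (m : ℝ) (φ : ℝ → Euc n × Euc p → F) : Prop :=
  ∀ K ⊆ Ω, IsCompact K → ∀ (α : List (Fin p)) (β : List (Fin n)), ∀ q : ℕ,
    ∃ C > 0, ∃ η ∈ Set.Ioc (0:ℝ) 1, ∀ ε ∈ Set.Ioc (0:ℝ) η, ∀ y ∈ K,
      ∀ ξ : Euc p, ξ ≠ 0 →
      ‖ξ‖ ^ (-m + (α.length : ℝ)) *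
        ‖dirDs (α.map eXi ++ β.map eY) (φ ε) (y, ξ)‖ ≤ C * ε ^ q

/-- Net of phase functions on Ω×ℝ^p. -/
def IsPhaseNet {n p : ℕ} (Ω : Set (Euc n)) (φ : ℝ → Euc n × Euc p → ℝ) : Prop :=
  ∀ ε ∈ Set.Ioc (0:ℝ) 1,
    ContDiffOn ℝ (⊤ : ℕ∞) (φ ε) (Ω ×ˢ {ξ : Euc p | ξ ≠ 0}) ∧
    (∀ y ∈ Ω, ∀ ξ : Euc p, ξ ≠ 0 → ∀ t : ℝ, 0 < t → φ ε (y, t • ξ) = t * φ ε (y, ξ)) ∧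
    (∀ y ∈ Ω, ∀ ξ : Euc p, ξ ≠ 0 → gradSq (φ ε) (y, ξ) ≠ 0)

/-- The set M_Φ(Ω×ℝ^p) of moderate nets of phase functions with strictly nonzero gradient. -/
def MPhi {n p : ℕ} (Ω : Set (Euc n)) (φ : ℝ → Euc n × Euc p → ℝ) : Prop :=
  IsPhaseNet Ω φ ∧ HgModerate Ω 1 φ ∧
  ∀ K ⊆ Ω, IsCompact K → ∃ r > (0:ℝ), ∃ η ∈ Set.Ioc (0:ℝ) 1, ∀ ε ∈ Set.Ioc (0:ℝ) η,
    ∀ y ∈ K, ∀ ξ : Euc p, ξ ≠ 0 → ε ^ r ≤ gradSq (φ ε) (y, ‖ξ‖⁻¹ • ξ)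

/-- Slow scale moderateness in S^m_hg. -/
def HgSlowScale {n p : ℕ} {F : Type*} [NormedAddCommGroup F] [NormedSpace ℝ F]
    (Ω : Set (Euc n)) (m : ℝ) (φ : ℝ → Euc n × Euc p → F) : Prop :=
  ∀ K ⊆ Ω, IsCompact K → ∀ (α : List (Fin p)) (β : List (Fin n)),
    ∃ s : ℝ → ℝ, SlowScale s ∧ ∃ η ∈ Set.Ioc (0:ℝ) 1, ∀ ε ∈ Set.Ioc (0:ℝ) η, ∀ y ∈ K,
      ∀ ξ : Euc p, ξ ≠ 0 →
      ‖ξ‖ ^ (-m + (α.length : ℝ)) *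
        ‖dirDs (α.map eXi ++ β.map eY) (φ ε) (y, ξ)‖ ≤ s ε

/-- Slow scale nets of phase functions M_{Φ,sc}(Ω×ℝ^p). -/
def MPhiSc {n p : ℕ} (Ω : Set (Euc n)) (φ : ℝ → Euc n × Euc p → ℝ) : Prop :=
  IsPhaseNet Ω φ ∧ HgSlowScale Ω 1 φ ∧
  ∀ K ⊆ Ω, IsCompact K → ∃ s : ℝ → ℝ, SlowScale s ∧ ∃ η ∈ Set.Ioc (0:ℝ) 1,
    ∀ ε ∈ Set.Ioc (0:ℝ) η, ∀ y ∈ K, ∀ ξ : Euc p, ξ ≠ 0 →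
      (s ε)⁻¹ ≤ gradSq (φ ε) (y, ‖ξ‖⁻¹ • ξ)

/-- cut-off function equal to 1 for |ξ|<1/4 and 0 for |ξ|>1/2. -/
def IsCutoff {p : ℕ} (χ : Euc p → ℝ) : Prop :=
  ContDiff ℝ (⊤ : ℕ∞) χ ∧ (∀ ξ : Euc p, ‖ξ‖ < 1/4 → χ ξ = 1) ∧ (∀ ξ : Euc p, 1/2 < ‖ξ‖ → χ ξ = 0)

/-- 1/|∇_{y,ξ}φ(y,ξ/|ξ|)|². -/
def varphiN {n p : ℕ} (φ : Euc n × Euc p → ℝ) (z : Euc n × Euc p) : ℝ :=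
  (gradSq φ (z.1, ‖z.2‖⁻¹ • z.2))⁻¹

def coefA {n p : ℕ} (χ : Euc p → ℝ) (φ : Euc n × Euc p → ℝ) (j : Fin p) :
    Euc n × Euc p → ℂ :=
  fun z => Complex.I * (((1 - χ z.2) * varphiN φ z * dirD (eXi j) φ z : ℝ) : ℂ)

def coefB {n p : ℕ} (χ : Euc p → ℝ) (φ : Euc n × Euc p → ℝ) (k : Fin n) :
    Euc n × Euc p → ℂ :=
  fun z => Complex.I * (((1 - χ z.2) * (‖z.2‖ ^ 2)⁻¹ * varphiN φ z * dirD (eY k) φ z : ℝ) : ℂ)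

def coefC {n p : ℕ} (χ : Euc p → ℝ) (φ : Euc n × Euc p → ℝ) : Euc n × Euc p → ℂ :=
  fun z => ((χ z.2 : ℝ) : ℂ) + (∑ j : Fin p, dirD (eXi j) (coefA χ φ j) z)
    + ∑ k : Fin n, dirD (eY k) (coefB χ φ k) z

/-- The operator L_φ. -/
def Lop {n p : ℕ} (χ : Euc p → ℝ) (φ : Euc n × Euc p → ℝ) (f : Euc n × Euc p → ℂ) :
    Euc n × Euc p → ℂ :=
  fun z => (∑ j : Fin p, coefA χ φ j z * dirD (eXi j) f z)
    + (∑ k : Fin n, coefB χ φ k z * dirD (eY k) f z) + coefC χ φ z * f z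

/-- Moderate nets of smooth functions E_M(Ω). -/
def EMod {d : ℕ} (Ω : Set (Euc d)) (v : ℝ → Euc d → ℂ) : Prop :=
  (∀ ε ∈ Set.Ioc (0:ℝ) 1, ContDiffOn ℝ (⊤ : ℕ∞) (v ε) Ω) ∧
  ∀ K ⊆ Ω, IsCompact K → ∀ L : List (Fin d),
    ∃ N : ℕ, ∃ C > 0, ∃ η ∈ Set.Ioc (0:ℝ) 1, ∀ ε ∈ Set.Ioc (0:ℝ) η, ∀ x ∈ K,
      ‖dirDs (basisL L) (v ε) x‖ ≤ C * ε ^ (-(N : ℤ))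

/-- Regular nets of smooth functions E^∞_M(Ω). -/
def EModInf {d : ℕ} (Ω : Set (Euc d)) (v : ℝ → Euc d → ℂ) : Prop :=
  (∀ ε ∈ Set.Ioc (0:ℝ) 1, ContDiffOn ℝ (⊤ : ℕ∞) (v ε) Ω) ∧
  ∀ K ⊆ Ω, IsCompact K → ∃ N : ℕ, ∀ L : List (Fin d),
    ∃ C > 0, ∃ η ∈ Set.Ioc (0:ℝ) 1, ∀ ε ∈ Set.Ioc (0:ℝ) η, ∀ x ∈ K,
      ‖dirDs (basisL L) (v ε) x‖ ≤ C * ε ^ (-(N : ℤ))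

/-- Moderate net in S^m_{ρ,δ}(Ω'×Ω×ℝ^p). -/
def Symb3Moderate {q n p : ℕ} (Ω' : Set (Euc q)) (Ω : Set (Euc n)) (m ρ δ : ℝ)
    (a : ℝ → Euc q × Euc n × Euc p → ℂ) : Prop :=
  (∀ ε ∈ Set.Ioc (0:ℝ) 1, ContDiffOn ℝ (⊤ : ℕ∞) (a ε) (Ω' ×ˢ Ω ×ˢ (univ : Set (Euc p)))) ∧
  (∀ ε ∈ Set.Ioc (0:ℝ) 1, ∀ K' ⊆ Ω', IsCompact K' → ∀ K ⊆ Ω, IsCompact K →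
    ∀ (α : List (Fin p)) (βx : List (Fin q)) (βy : List (Fin n)),
    ∃ C : ℝ, ∀ x ∈ K', ∀ y ∈ K, ∀ ξ : Euc p,
      jb ξ ^ (-m + ρ * (α.length : ℝ) - δ * ((βx.length + βy.length : ℕ) : ℝ)) *
        ‖dirDs (α.map eXi3 ++ βx.map eX3 ++ βy.map eY3) (a ε) (x, y, ξ)‖ ≤ C) ∧
  ∀ K' ⊆ Ω', IsCompact K' → ∀ K ⊆ Ω, IsCompact K →
    ∀ (α : List (Fin p)) (βx : List (Fin q)) (βy : List (Fin n)),
    ∃ N : ℕ, ∃ C > 0, ∃ η ∈ Set.Ioc (0:ℝ) 1, ∀ ε ∈ Set.Ioc (0:ℝ) η,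
      ∀ x ∈ K', ∀ y ∈ K, ∀ ξ : Euc p,
      jb ξ ^ (-m + ρ * (α.length : ℝ) - δ * ((βx.length + βy.length : ℕ) : ℝ)) *
        ‖dirDs (α.map eXi3 ++ βx.map eX3 ++ βy.map eY3) (a ε) (x, y, ξ)‖ ≤ C * ε ^ (-(N : ℤ))

/-- Regular net in S^m_{ρ,δ}(Ω'×Ω×ℝ^p). -/
def Symb3Regular {q n p : ℕ} (Ω' : Set (Euc q)) (Ω : Set (Euc n)) (m ρ δ : ℝ)
    (a : ℝ → Euc q × Euc n × Euc p → ℂ) : Prop :=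
  (∀ ε ∈ Set.Ioc (0:ℝ) 1, ContDiffOn ℝ (⊤ : ℕ∞) (a ε) (Ω' ×ˢ Ω ×ˢ (univ : Set (Euc p)))) ∧
  (∀ ε ∈ Set.Ioc (0:ℝ) 1, ∀ K' ⊆ Ω', IsCompact K' → ∀ K ⊆ Ω, IsCompact K →
    ∀ (α : List (Fin p)) (βx : List (Fin q)) (βy : List (Fin n)),
    ∃ C : ℝ, ∀ x ∈ K', ∀ y ∈ K, ∀ ξ : Euc p,
      jb ξ ^ (-m + ρ * (α.length : ℝ) - δ * ((βx.length + βy.length : ℕ) : ℝ)) *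
        ‖dirDs (α.map eXi3 ++ βx.map eX3 ++ βy.map eY3) (a ε) (x, y, ξ)‖ ≤ C) ∧
  ∀ K' ⊆ Ω', IsCompact K' → ∀ K ⊆ Ω, IsCompact K → ∃ N : ℕ,
    ∀ (α : List (Fin p)) (βx : List (Fin q)) (βy : List (Fin n)),
    ∃ C > 0, ∃ η ∈ Set.Ioc (0:ℝ) 1, ∀ ε ∈ Set.Ioc (0:ℝ) η,
      ∀ x ∈ K', ∀ y ∈ K, ∀ ξ : Euc p,
      jb ξ ^ (-m + ρ * (α.length : ℝ) - δ * ((βx.length + βy.length : ℕ) : ℝ)) *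
        ‖dirDs (α.map eXi3 ++ βx.map eX3 ++ βy.map eY3) (a ε) (x, y, ξ)‖ ≤ C * ε ^ (-(N : ℤ))

/-- Moderate net of order −∞ on Ω'×Ω×ℝ^p. -/
def Smoothing3Moderate {q n p : ℕ} (Ω' : Set (Euc q)) (Ω : Set (Euc n))
    (a : ℝ → Euc q × Euc n × Euc p → ℂ) : Prop :=
  (∀ ε ∈ Set.Ioc (0:ℝ) 1, ContDiffOn ℝ (⊤ : ℕ∞) (a ε) (Ω' ×ˢ Ω ×ˢ (univ : Set (Euc p)))) ∧
  (∀ ε ∈ Set.Ioc (0:ℝ) 1, ∀ m : ℝ, ∀ K' ⊆ Ω', IsCompact K' → ∀ K ⊆ Ω, IsCompact K →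
    ∀ (α : List (Fin p)) (βx : List (Fin q)) (βy : List (Fin n)),
    ∃ C : ℝ, ∀ x ∈ K', ∀ y ∈ K, ∀ ξ : Euc p,
      jb ξ ^ (-m + (α.length : ℝ)) *
        ‖dirDs (α.map eXi3 ++ βx.map eX3 ++ βy.map eY3) (a ε) (x, y, ξ)‖ ≤ C) ∧
  ∀ m : ℝ, ∀ K' ⊆ Ω', IsCompact K' → ∀ K ⊆ Ω, IsCompact K →
    ∀ (α : List (Fin p)) (βx : List (Fin q)) (βy : List (Fin n)),
    ∃ N : ℕ, ∃ C > 0, ∃ η ∈ Set.Ioc (0:ℝ) 1, ∀ ε ∈ Set.Ioc (0:ℝ) η,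
      ∀ x ∈ K', ∀ y ∈ K, ∀ ξ : Euc p,
      jb ξ ^ (-m + (α.length : ℝ)) *
        ‖dirDs (α.map eXi3 ++ βx.map eX3 ++ βy.map eY3) (a ε) (x, y, ξ)‖ ≤ C * ε ^ (-(N : ℤ))

/-- Regular net of order −∞ on Ω'×Ω×ℝ^p. -/
def Smoothing3Regular {q n p : ℕ} (Ω' : Set (Euc q)) (Ω : Set (Euc n))
    (a : ℝ → Euc q × Euc n × Euc p → ℂ) : Prop :=
  (∀ ε ∈ Set.Ioc (0:ℝ) 1, ContDiffOn ℝ (⊤ : ℕ∞) (a ε) (Ω' ×ˢ Ω ×ˢ (univ : Set (Euc p)))) ∧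
  (∀ ε ∈ Set.Ioc (0:ℝ) 1, ∀ m : ℝ, ∀ K' ⊆ Ω', IsCompact K' → ∀ K ⊆ Ω, IsCompact K →
    ∀ (α : List (Fin p)) (βx : List (Fin q)) (βy : List (Fin n)),
    ∃ C : ℝ, ∀ x ∈ K', ∀ y ∈ K, ∀ ξ : Euc p,
      jb ξ ^ (-m + (α.length : ℝ)) *
        ‖dirDs (α.map eXi3 ++ βx.map eX3 ++ βy.map eY3) (a ε) (x, y, ξ)‖ ≤ C) ∧
  ∀ K' ⊆ Ω', IsCompact K' → ∀ K ⊆ Ω, IsCompact K → ∃ N : ℕ, ∀ m : ℝ,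
    ∀ (α : List (Fin p)) (βx : List (Fin q)) (βy : List (Fin n)),
    ∃ C > 0, ∃ η ∈ Set.Ioc (0:ℝ) 1, ∀ ε ∈ Set.Ioc (0:ℝ) η,
      ∀ x ∈ K', ∀ y ∈ K, ∀ ξ : Euc p,
      jb ξ ^ (-m + (α.length : ℝ)) *
        ‖dirDs (α.map eXi3 ++ βx.map eX3 ++ βy.map eY3) (a ε) (x, y, ξ)‖ ≤ C * ε ^ (-(N : ℤ))

/-- Nets of phase functions with parameter x ∈ Ω'. -/
def IsPhaseNet3 {q n p : ℕ} (Ω' : Set (Euc q)) (Ω : Set (Euc n))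
    (φ : ℝ → Euc q × Euc n × Euc p → ℝ) : Prop :=
  ∀ ε ∈ Set.Ioc (0:ℝ) 1,
    ContinuousOn (φ ε) (Ω' ×ˢ Ω ×ˢ (univ : Set (Euc p))) ∧
    ContDiffOn ℝ (⊤ : ℕ∞) (φ ε) (Ω' ×ˢ Ω ×ˢ {ξ : Euc p | ξ ≠ 0}) ∧
    (∀ x ∈ Ω', ∀ y ∈ Ω, ∀ ξ : Euc p, ξ ≠ 0 → ∀ t : ℝ, 0 < t →
      φ ε (x, y, t • ξ) = t * φ ε (x, y, ξ)) ∧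
    (∀ x ∈ Ω', ∀ y ∈ Ω, ∀ ξ : Euc p, ξ ≠ 0 → gradSq3 (φ ε) (x, y, ξ) ≠ 0)

/-- S^1_hg-moderateness in all variables for parametrized phase nets. -/
def Hg3Moderate {q n p : ℕ} (Ω' : Set (Euc q)) (Ω : Set (Euc n)) (m : ℝ)
    (φ : ℝ → Euc q × Euc n × Euc p → ℝ) : Prop :=
  ∀ K' ⊆ Ω', IsCompact K' → ∀ K ⊆ Ω, IsCompact K →
    ∀ (α : List (Fin p)) (βx : List (Fin q)) (βy : List (Fin n)),
    ∃ N : ℕ, ∃ C > 0, ∃ η ∈ Set.Ioc (0:ℝ) 1, ∀ ε ∈ Set.Ioc (0:ℝ) η,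
      ∀ x ∈ K', ∀ y ∈ K, ∀ ξ : Euc p, ξ ≠ 0 →
      ‖ξ‖ ^ (-m + (α.length : ℝ)) *
        ‖dirDs (α.map eXi3 ++ βx.map eX3 ++ βy.map eY3) (φ ε) (x, y, ξ)‖ ≤ C * ε ^ (-(N : ℤ))

def Hg3SlowScale {q n p : ℕ} (Ω' : Set (Euc q)) (Ω : Set (Euc n)) (m : ℝ)
    (φ : ℝ → Euc q × Euc n × Euc p → ℝ) : Prop :=
  ∀ K' ⊆ Ω', IsCompact K' → ∀ K ⊆ Ω, IsCompact K →
    ∀ (α : List (Fin p)) (βx : List (Fin q)) (βy : List (Fin n)),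
    ∃ s : ℝ → ℝ, SlowScale s ∧ ∃ η ∈ Set.Ioc (0:ℝ) 1, ∀ ε ∈ Set.Ioc (0:ℝ) η,
      ∀ x ∈ K', ∀ y ∈ K, ∀ ξ : Euc p, ξ ≠ 0 →
      ‖ξ‖ ^ (-m + (α.length : ℝ)) *
        ‖dirDs (α.map eXi3 ++ βx.map eX3 ++ βy.map eY3) (φ ε) (x, y, ξ)‖ ≤ s ε

/-- M_Φ(Ω';Ω×ℝ^p). -/
def MPhi3 {q n p : ℕ} (Ω' : Set (Euc q)) (Ω : Set (Euc n))
    (φ : ℝ → Euc q × Euc n × Euc p → ℝ) : Prop :=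
  IsPhaseNet3 Ω' Ω φ ∧ Hg3Moderate Ω' Ω 1 φ ∧
  ∀ K' ⊆ Ω', IsCompact K' → ∀ K ⊆ Ω, IsCompact K →
    ∃ r > (0:ℝ), ∃ η ∈ Set.Ioc (0:ℝ) 1, ∀ ε ∈ Set.Ioc (0:ℝ) η,
      ∀ x ∈ K', ∀ y ∈ K, ∀ ξ : Euc p, ξ ≠ 0 →
        ε ^ r ≤ gradSq3 (φ ε) (x, y, ‖ξ‖⁻¹ • ξ)

/-- M_{Φ,sc}(Ω';Ω×ℝ^p). -/
def MPhi3Sc {q n p : ℕ} (Ω' : Set (Euc q)) (Ω : Set (Euc n))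
    (φ : ℝ → Euc q × Euc n × Euc p → ℝ) : Prop :=
  IsPhaseNet3 Ω' Ω φ ∧ Hg3SlowScale Ω' Ω 1 φ ∧
  ∀ K' ⊆ Ω', IsCompact K' → ∀ K ⊆ Ω, IsCompact K →
    ∃ s : ℝ → ℝ, SlowScale s ∧ ∃ η ∈ Set.Ioc (0:ℝ) 1, ∀ ε ∈ Set.Ioc (0:ℝ) η,
      ∀ x ∈ K', ∀ y ∈ K, ∀ ξ : Euc p, ξ ≠ 0 →
        (s ε)⁻¹ ≤ gradSq3 (φ ε) (x, y, ‖ξ‖⁻¹ • ξ)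

def varphiN3 {q n p : ℕ} (φ : Euc q × Euc n × Euc p → ℝ) (z : Euc q × Euc n × Euc p) : ℝ :=
  (gradSq3 φ (z.1, z.2.1, ‖z.2.2‖⁻¹ • z.2.2))⁻¹

def coefA3 {q n p : ℕ} (χ : Euc p → ℝ) (φ : Euc q × Euc n × Euc p → ℝ) (j : Fin p) :
    Euc q × Euc n × Euc p → ℂ :=
  fun z => Complex.I * (((1 - χ z.2.2) * varphiN3 φ z * dirD (eXi3 j) φ z : ℝ) : ℂ)

def coefB3 {q n p : ℕ} (χ : Euc p → ℝ) (φ : Euc q × Euc n × Euc p → ℝ) (k : Fin n) :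
    Euc q × Euc n × Euc p → ℂ :=
  fun z => Complex.I * (((1 - χ z.2.2) * (‖z.2.2‖ ^ 2)⁻¹ * varphiN3 φ z * dirD (eY3 k) φ z : ℝ) : ℂ)

def coefC3 {q n p : ℕ} (χ : Euc p → ℝ) (φ : Euc q × Euc n × Euc p → ℝ) :
    Euc q × Euc n × Euc p → ℂ :=
  fun z => ((χ z.2.2 : ℝ) : ℂ) + (∑ j : Fin p, dirD (eXi3 j) (coefA3 χ φ j) z)
    + ∑ k : Fin n, dirD (eY3 k) (coefB3 χ φ k) z

/-- The operator L_φ(x;y,ξ,∂_y,∂_ξ). -/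
def Lop3 {q n p : ℕ} (χ : Euc p → ℝ) (φ : Euc q × Euc n × Euc p → ℝ)
    (f : Euc q × Euc n × Euc p → ℂ) : Euc q × Euc n × Euc p → ℂ :=
  fun z => (∑ j : Fin p, coefA3 χ φ j z * dirD (eXi3 j) f z)
    + (∑ k : Fin n, coefB3 χ φ k z * dirD (eY3 k) f z) + coefC3 χ φ z * f z


/-- Moderate net of order −∞ on Ω×ℝ^p. -/
def SmoothingModerate {n p : ℕ} (Ω : Set (Euc n)) (a : ℝ → Euc n × Euc p → ℂ) : Prop :=
  (∀ ε ∈ Set.Ioc (0:ℝ) 1, ContDiffOn ℝ (⊤ : ℕ∞) (a ε) (Ω ×ˢ (univ : Set (Euc p)))) ∧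
  (∀ ε ∈ Set.Ioc (0:ℝ) 1, ∀ m : ℝ, ∀ K ⊆ Ω, IsCompact K →
    ∀ (α : List (Fin p)) (β : List (Fin n)),
    ∃ C : ℝ, ∀ y ∈ K, ∀ ξ : Euc p,
      jb ξ ^ (-m + (α.length : ℝ)) *
        ‖dirDs (α.map eXi ++ β.map eY) (a ε) (y, ξ)‖ ≤ C) ∧
  ∀ m : ℝ, ∀ K ⊆ Ω, IsCompact K → ∀ (α : List (Fin p)) (β : List (Fin n)),
    ∃ N : ℕ, ∃ C > 0, ∃ η ∈ Set.Ioc (0:ℝ) 1, ∀ ε ∈ Set.Ioc (0:ℝ) η, ∀ y ∈ K, ∀ ξ : Euc p,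
      jb ξ ^ (-m + (α.length : ℝ)) *
        ‖dirDs (α.map eXi ++ β.map eY) (a ε) (y, ξ)‖ ≤ C * ε ^ (-(N : ℤ))

/-- Regular net of order −∞ on Ω×ℝ^p. -/
def SmoothingRegular {n p : ℕ} (Ω : Set (Euc n)) (a : ℝ → Euc n × Euc p → ℂ) : Prop :=
  (∀ ε ∈ Set.Ioc (0:ℝ) 1, ContDiffOn ℝ (⊤ : ℕ∞) (a ε) (Ω ×ˢ (univ : Set (Euc p)))) ∧
  (∀ ε ∈ Set.Ioc (0:ℝ) 1, ∀ m : ℝ, ∀ K ⊆ Ω, IsCompact K →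
    ∀ (α : List (Fin p)) (β : List (Fin n)),
    ∃ C : ℝ, ∀ y ∈ K, ∀ ξ : Euc p,
      jb ξ ^ (-m + (α.length : ℝ)) *
        ‖dirDs (α.map eXi ++ β.map eY) (a ε) (y, ξ)‖ ≤ C) ∧
  ∀ K ⊆ Ω, IsCompact K → ∃ N : ℕ, ∀ m : ℝ, ∀ (α : List (Fin p)) (β : List (Fin n)),
    ∃ C > 0, ∃ η ∈ Set.Ioc (0:ℝ) 1, ∀ ε ∈ Set.Ioc (0:ℝ) η, ∀ y ∈ K, ∀ ξ : Euc p,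
      jb ξ ^ (-m + (α.length : ℝ)) *
        ‖dirDs (α.map eXi ++ β.map eY) (a ε) (y, ξ)‖ ≤ C * ε ^ (-(N : ℤ))

/-- Moderate net in S^m_{ρ,δ}(V) on the conic set V = Ω×(ℝ^p∖0). -/
def ConicModerate {n p : ℕ} (Ω : Set (Euc n)) (m ρ δ : ℝ)
    (a : ℝ → Euc n × Euc p → ℂ) : Prop :=
  (∀ ε ∈ Set.Ioc (0:ℝ) 1, ContDiffOn ℝ (⊤ : ℕ∞) (a ε) (Ω ×ˢ {ξ : Euc p | ξ ≠ 0})) ∧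
  (∀ ε ∈ Set.Ioc (0:ℝ) 1, ∀ K ⊆ Ω ×ˢ {ξ : Euc p | ξ ≠ 0}, IsCompact K →
    ∀ (α : List (Fin p)) (β : List (Fin n)), ∃ C : ℝ, ∀ z ∈ K, ∀ t : ℝ, 1 ≤ t →
      jb (t • z.2) ^ (-m + ρ * (α.length : ℝ) - δ * (β.length : ℝ)) *
        ‖dirDs (α.map eXi ++ β.map eY) (a ε) (z.1, t • z.2)‖ ≤ C) ∧
  ∀ K ⊆ Ω ×ˢ {ξ : Euc p | ξ ≠ 0}, IsCompact K →
    ∀ (α : List (Fin p)) (β : List (Fin n)),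
    ∃ N : ℕ, ∃ C > 0, ∃ η ∈ Set.Ioc (0:ℝ) 1, ∀ ε ∈ Set.Ioc (0:ℝ) η, ∀ z ∈ K, ∀ t : ℝ, 1 ≤ t →
      jb (t • z.2) ^ (-m + ρ * (α.length : ℝ) - δ * (β.length : ℝ)) *
        ‖dirDs (α.map eXi ++ β.map eY) (a ε) (z.1, t • z.2)‖ ≤ C * ε ^ (-(N : ℤ))

/-- Negligible net in S^m_{ρ,δ}(V) on the conic set V = Ω×(ℝ^p∖0). -/
def ConicNegligible {n p : ℕ} (Ω : Set (Euc n)) (m ρ δ : ℝ)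
    (a : ℝ → Euc n × Euc p → ℂ) : Prop :=
  (∀ ε ∈ Set.Ioc (0:ℝ) 1, ContDiffOn ℝ (⊤ : ℕ∞) (a ε) (Ω ×ˢ {ξ : Euc p | ξ ≠ 0})) ∧
  (∀ ε ∈ Set.Ioc (0:ℝ) 1, ∀ K ⊆ Ω ×ˢ {ξ : Euc p | ξ ≠ 0}, IsCompact K →
    ∀ (α : List (Fin p)) (β : List (Fin n)), ∃ C : ℝ, ∀ z ∈ K, ∀ t : ℝ, 1 ≤ t →
      jb (t • z.2) ^ (-m + ρ * (α.length : ℝ) - δ * (β.length : ℝ)) *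
        ‖dirDs (α.map eXi ++ β.map eY) (a ε) (z.1, t • z.2)‖ ≤ C) ∧
  ∀ K ⊆ Ω ×ˢ {ξ : Euc p | ξ ≠ 0}, IsCompact K →
    ∀ (α : List (Fin p)) (β : List (Fin n)), ∀ q : ℕ,
    ∃ C > 0, ∃ η ∈ Set.Ioc (0:ℝ) 1, ∀ ε ∈ Set.Ioc (0:ℝ) η, ∀ z ∈ K, ∀ t : ℝ, 1 ≤ t →
      jb (t • z.2) ^ (-m + ρ * (α.length : ℝ) - δ * (β.length : ℝ)) *
        ‖dirDs (α.map eXi ++ β.map eY) (a ε) (z.1, t • z.2)‖ ≤ C * ε ^ q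

/-- A point (x₀,ξ₀) at which |∇_ξφ|² is invertible on a neighborhood U×Γ. -/
def InvPt {n p : ℕ} (Ω : Set (Euc n)) (φ : ℝ → Euc n × Euc p → ℝ)
    (z : Euc n × Euc p) : Prop :=
  ∃ U : Set (Euc n), IsOpen U ∧ z.1 ∈ U ∧ U ⊆ Ω ∧ IsCompact (closure U) ∧
  ∃ Γ : Set (Euc p), IsOpen Γ ∧ z.2 ∈ Γ ∧ (∀ ξ ∈ Γ, ∀ t : ℝ, 0 < t → t • ξ ∈ Γ) ∧
  ∃ r : ℝ, ∃ η ∈ Set.Ioc (0:ℝ) 1, ∀ ε ∈ Set.Ioc (0:ℝ) η, ∀ y ∈ U, ∀ ξ ∈ Γ,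
    ε ^ r ≤ gradXiSq (φ ε) (y, ξ)

/-- A point (x₀,ξ₀) at which |∇_ξφ|² is slow scale-invertible on a neighborhood U×Γ. -/
def InvPtSc {n p : ℕ} (Ω : Set (Euc n)) (φ : ℝ → Euc n × Euc p → ℝ)
    (z : Euc n × Euc p) : Prop :=
  ∃ U : Set (Euc n), IsOpen U ∧ z.1 ∈ U ∧ U ⊆ Ω ∧ IsCompact (closure U) ∧
  ∃ Γ : Set (Euc p), IsOpen Γ ∧ z.2 ∈ Γ ∧ (∀ ξ ∈ Γ, ∀ t : ℝ, 0 < t → t • ξ ∈ Γ) ∧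
  ∃ s : ℝ → ℝ, SlowScale s ∧ ∃ η ∈ Set.Ioc (0:ℝ) 1, ∀ ε ∈ Set.Ioc (0:ℝ) η, ∀ y ∈ U, ∀ ξ ∈ Γ,
    (s ε)⁻¹ ≤ gradXiSq (φ ε) (y, ξ)

/-- The set C_φ. -/
def Cphi {n p : ℕ} (Ω : Set (Euc n)) (φ : ℝ → Euc n × Euc p → ℝ) : Set (Euc n × Euc p) :=
  {z | z.1 ∈ Ω ∧ z.2 ≠ 0 ∧ ¬ InvPt Ω φ z}

/-- The set R_φ = Ω ∖ π_Ω(C_φ). -/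
def Rphi {n p : ℕ} (Ω : Set (Euc n)) (φ : ℝ → Euc n × Euc p → ℝ) : Set (Euc n) :=
  Ω \ (Prod.fst '' Cphi Ω φ)

/-- The set C^sc_φ. -/
def CphiSc {n p : ℕ} (Ω : Set (Euc n)) (φ : ℝ → Euc n × Euc p → ℝ) : Set (Euc n × Euc p) :=
  {z | z.1 ∈ Ω ∧ z.2 ≠ 0 ∧ ¬ InvPtSc Ω φ z}

/-- The set R^sc_φ = Ω ∖ π_Ω(C^sc_φ). -/
def RphiSc {n p : ℕ} (Ω : Set (Euc n)) (φ : ℝ → Euc n × Euc p → ℝ) : Set (Euc n) :=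
  Ω \ (Prod.fst '' CphiSc Ω φ)

/-- 1/|∇_ξφ(y,ξ/|ξ|)|². -/
def varphiXi {n p : ℕ} (φ : Euc n × Euc p → ℝ) (z : Euc n × Euc p) : ℝ :=
  (gradXiSq φ (z.1, ‖z.2‖⁻¹ • z.2))⁻¹

/-- The transposed regularizing operator in the ξ-variables only:
    ᵗL f = −Σ_j a_j ∂_{ξ_j} f + χ f  with a_j = i(1−χ)|∇_ξφ|⁻²∂_{ξ_j}φ. -/
def tLxi {n p : ℕ} (χ : Euc p → ℝ) (φ : Euc n × Euc p → ℝ) (f : Euc n × Euc p → ℂ) :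
    Euc n × Euc p → ℂ :=
  fun z => -(∑ j : Fin p,
      (Complex.I * (((1 - χ z.2) * varphiXi φ z * dirD (eXi j) φ z : ℝ) : ℂ)) *
        dirD (eXi j) f z)
    + ((χ z.2 : ℝ) : ℂ) * f z

/-- d_{j}(y,θ,ξ) = (ξ_j − ∂_{y_j}φ(y,θ))/|ξ−∇_yφ(y,θ)|². -/
def dj {n p : ℕ} (φ : Euc n × Euc p → ℝ) (ξ : Euc n) (j : Fin n)
    (z : Euc n × Euc p) : ℝ :=
  (ξ j - dirD (eY j) φ z) / ‖ξ - gradY φ z‖ ^ 2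

/-- ᵗL_ε f = −Σ_j d_j D_{y_j} f − Σ_j (D_{y_j} d_j) f, with D_{y_j} = −i∂_{y_j}. -/
def tLW {n p : ℕ} (φ : Euc n × Euc p → ℝ) (ξ : Euc n) (f : Euc n × Euc p → ℂ) :
    Euc n × Euc p → ℂ :=
  fun z => -(∑ j : Fin n, ((dj φ ξ j z : ℝ) : ℂ) * (-Complex.I * dirD (eY j) f z))
    - ∑ j : Fin n, (-Complex.I * ((dirD (eY j) (dj φ ξ j) z : ℝ) : ℂ)) * f z

lemma list_map_prod_nonneg {E : Type*} {w : E → ℝ} (hw : ∀ v, 0 ≤ w v) (L : List E) :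
    0 ≤ (L.map w).prod := by
  apply List.prod_nonneg
  simp only [List.mem_map]
  rintro _ ⟨v, _, rfl⟩
  exact hw v

section DirectionalDerivatives

variable {E F : Type*} [NormedAddCommGroup E] [NormedSpace ℝ E]
  [NormedAddCommGroup F] [NormedSpace ℝ F]

lemma dirDs_append (L M : List E) (f : E → F) :
    dirDs (L ++ M) f = dirDs L (dirDs M f) := by
  simp [dirDs, List.foldr_append]

lemma dirD_congr {U : Set E} (hU : IsOpen U) {f g : E → F} (h : EqOn f g U) (v : E) :
    EqOn (dirD v f) (dirD v g) U := by
  intro z hz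
  have : f =ᶠ[𝓝 z] g := Filter.eventuallyEq_of_mem (hU.mem_nhds hz) h
  simp only [dirD, this.fderiv_eq]

lemma dirDs_congr {U : Set E} (hU : IsOpen U) {f g : E → F} (h : EqOn f g U) (L : List E) :
    EqOn (dirDs L f) (dirDs L g) U := by
  induction L with
  | nil => exact h
  | cons v L ih => exact dirD_congr hU ih v

lemma ContDiffOn.dirD {U : Set E} (hU : IsOpen U) {f : E → F}
    (hf : ContDiffOn ℝ (⊤ : ℕ∞) f U) (v : E) : ContDiffOn ℝ (⊤ : ℕ∞) (dirD v f) U := by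
  have h : ContDiffOn ℝ (⊤ : ℕ∞) (fderiv ℝ f) U :=
    hf.fderiv_of_isOpen hU (by simp)
  exact h.clm_apply contDiffOn_const

lemma ContDiffOn.dirDs {U : Set E} (hU : IsOpen U) {f : E → F}
    (hf : ContDiffOn ℝ (⊤ : ℕ∞) f U) (L : List E) : ContDiffOn ℝ (⊤ : ℕ∞) (dirDs L f) U := by
  induction L with
  | nil => exact hf
  | cons v L ih => exact ih.dirD hU v

lemma differentiableAt_of_contDiffOn_top {U : Set E} (hU : IsOpen U) {f : E → F}
    (hf : ContDiffOn ℝ (⊤ : ℕ∞) f U) {z : E} (hz : z ∈ U) : DifferentiableAt ℝ f z :=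
  (hf.contDiffAt (hU.mem_nhds hz)).differentiableAt (by simp)

lemma dirDs_add {U : Set E} (hU : IsOpen U) {f g : E → F}
    (hf : ContDiffOn ℝ (⊤ : ℕ∞) f U) (hg : ContDiffOn ℝ (⊤ : ℕ∞) g U) (L : List E) :
    EqOn (dirDs L (fun z => f z + g z)) (fun z => dirDs L f z + dirDs L g z) U := by
  induction L with
  | nil => exact fun z _ => rfl
  | cons v L ih =>
    intro z hz
    refine (dirD_congr hU ih v hz).trans ?_
    have h1 := differentiableAt_of_contDiffOn_top hU (hf.dirDs hU L) hz
    have h2 := differentiableAt_of_contDiffOn_top hU (hg.dirDs hU L) hz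
    simp only [dirD]
    rw [fderiv_fun_add h1 h2]
    rfl

lemma dirDs_clm_comp {G : Type*} [NormedAddCommGroup G] [NormedSpace ℝ G]
    {U : Set E} (hU : IsOpen U) {f : E → F}
    (hf : ContDiffOn ℝ (⊤ : ℕ∞) f U) (T : F →L[ℝ] G) (L : List E) :
    EqOn (dirDs L (fun z => T (f z))) (fun z => T (dirDs L f z)) U := by
  induction L with
  | nil => exact fun z _ => rfl
  | cons v L ih =>
    intro z hz
    refine (dirD_congr hU ih v hz).trans ?_
    have h1 := differentiableAt_of_contDiffOn_top hU (hf.dirDs hU L) hz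
    have h2 := (T.hasFDerivAt.comp z h1.hasFDerivAt).fderiv
    have h3 : fderiv ℝ (fun z => T (dirDs L f z)) z = T.comp (fderiv ℝ (dirDs L f) z) := h2
    simp only [dirD]
    rw [h3]
    rfl

/-- Leibniz estimate: weighted bounds of the derivatives of two factors along all sublists of a
list of directions give a weighted bound for the product. -/
lemma norm_dirDs_mul_le {U : Set E} (hU : IsOpen U) {z : E} (hz : z ∈ U) (w : E → ℝ)
    (L : List E) : ∀ {f g : E → ℂ}, ContDiffOn ℝ (⊤ : ℕ∞) f U → ContDiffOn ℝ (⊤ : ℕ∞) g U →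
    ∀ {a b : ℝ},
      (∀ S, S.Sublist L → ‖dirDs S f z‖ ≤ a * (S.map w).prod) →
      (∀ S, S.Sublist L → ‖dirDs S g z‖ ≤ b * (S.map w).prod) →
      ‖dirDs L (fun x => f x * g x) z‖ ≤ 2 ^ L.length * (a * b) * (L.map w).prod := by
  induction L using List.reverseRecOn with
  | nil =>
    intro f g _ _ a b ha hb
    have h1 := ha [] (List.Sublist.refl _)
    have h2 := hb [] (List.Sublist.refl _)
    simp only [dirDs, List.foldr_nil, List.map_nil, List.prod_nil, mul_one, List.length_nil,
      pow_zero, one_mul, norm_mul] at h1 h2 ⊢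
    exact mul_le_mul h1 h2 (norm_nonneg _) ((norm_nonneg _).trans h1)
  | append_singleton L v ih =>
    intro f g hf hg a b ha hb
    have hD : EqOn (dirD v (fun x => f x * g x))
        (fun x => dirD v f x * g x + f x * dirD v g x) U := by
      intro x hx
      simp only [dirD]
      rw [fderiv_fun_mul (differentiableAt_of_contDiffOn_top hU hf hx)
        (differentiableAt_of_contDiffOn_top hU hg hx)]
      simp
      ring
    have hL : L.Sublist (L ++ [v]) := List.sublist_append_left _ _
    have hv : ∀ {f : E → ℂ} {a : ℝ},
        (∀ S, S.Sublist (L ++ [v]) → ‖dirDs S f z‖ ≤ a * (S.map w).prod) →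
        ∀ S, S.Sublist L → ‖dirDs S (dirD v f) z‖ ≤ (a * w v) * (S.map w).prod := by
      intro f a h S hS
      have := h (S ++ [v]) (hS.append_right [v])
      rw [dirDs_append] at this
      refine this.trans_eq ?_
      simp
      ring
    have h1 := ih (hf.dirD hU v) hg (hv ha) fun S hS => hb S (hS.trans hL)
    have h2 := ih hf (hg.dirD hU v) (fun S hS => ha S (hS.trans hL)) (hv hb)
    rw [dirDs_append]
    have h3 := (dirDs_congr hU hD L hz).trans (dirDs_add hU ((hf.dirD hU v).mul hg)
      (hf.mul (hg.dirD hU v)) L hz)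
    change dirDs L (dirD v fun x => f x * g x) z = _ at h3
    change ‖dirDs L (dirD v fun x => f x * g x) z‖ ≤ _
    rw [h3]
    refine (norm_add_le _ _).trans ((add_le_add h1 h2).trans_eq ?_)
    simp [pow_succ]
    ring

lemma dirD_cexp {U : Set E} (hU : IsOpen U) {f : E → ℂ} (hf : ContDiffOn ℝ (⊤ : ℕ∞) f U)
    (v : E) : EqOn (dirD v (fun x => Complex.exp (f x)))
      (fun x => dirD v f x * Complex.exp (f x)) U := by
  intro x hx
  simp only [dirD]
  rw [((differentiableAt_of_contDiffOn_top hU hf hx).hasFDerivAt.cexp).fderiv]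
  simp
  ring

lemma norm_dirDs_cexp_le {U : Set E} (hU : IsOpen U) {z : E} (hz : z ∈ U) {w : E → ℝ}
    (hw : ∀ v, 0 ≤ w v) {f : E → ℂ} (hf : ContDiffOn ℝ (⊤ : ℕ∞) f U)
    (hfz : ‖Complex.exp (f z)‖ ≤ 1) {A : ℝ} (hA : 1 ≤ A) (m : ℕ) :
    ∀ L : List E, L.length ≤ m →
      (∀ S, S.Sublist L → S ≠ [] → ‖dirDs S f z‖ ≤ A * (S.map w).prod) →
      ‖dirDs L (fun x => Complex.exp (f x)) z‖ ≤ (2 ^ m * A) ^ m * (L.map w).prod := by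
  induction m with
  | zero =>
    intro L hL _
    obtain rfl : L = [] := by simpa using hL
    simpa [dirDs] using hfz
  | succ m ih =>
    intro L hL hS
    have h2A : (1 : ℝ) ≤ 2 ^ (m + 1) * A := one_le_mul_of_one_le_of_one_le
      (one_le_pow₀ (by norm_num)) hA
    rcases List.eq_nil_or_concat L with rfl | ⟨L, v, rfl⟩
    · simpa [dirDs] using hfz.trans (one_le_pow₀ h2A)
    · rw [List.concat_eq_append] at *
      have hL' : L.length ≤ m := by simpa using hL
      have hLv : L.Sublist (L ++ [v]) := List.sublist_append_left _ _
      have h1 := norm_dirDs_mul_le hU hz w L (hf.dirD hU v) hf.cexp (a := A * w v)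
        (b := (2 ^ m * A) ^ m) (by
          intro S hSL
          have := hS (S ++ [v]) (hSL.append_right [v]) (by simp)
          rw [dirDs_append] at this
          refine this.trans_eq ?_
          simp
          ring) (by
          intro S hSL
          exact ih S (hSL.length_le.trans hL') fun T hT => hS T (hT.trans (hSL.trans hLv)))
      rw [dirDs_append]
      have h2 := dirDs_congr hU (dirD_cexp hU hf v) L hz
      change ‖dirDs L (dirD v fun x => Complex.exp (f x)) z‖ ≤ _
      rw [h2]
      refine h1.trans ?_
      have hW := mul_nonneg (list_map_prod_nonneg hw L) (hw v)
      have hc : 2 ^ L.length * (A * (2 ^ m * A) ^ m) ≤ (2 ^ (m + 1) * A) ^ (m + 1) := by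
        calc 2 ^ L.length * (A * (2 ^ m * A) ^ m)
            ≤ 2 ^ (m + 1) * (A * (2 ^ (m + 1) * A) ^ m) := by
              gcongr <;> first | omega | norm_num
          _ = _ := by ring
      calc _ = 2 ^ L.length * (A * (2 ^ m * A) ^ m) * ((L.map w).prod * w v) := by ring
        _ ≤ (2 ^ (m + 1) * A) ^ (m + 1) * ((L.map w).prod * w v) := by gcongr
        _ = _ := by simp

lemma norm_dirDs_cexp_sub_cexp_le {U : Set E} (hU : IsOpen U) {z : E} (hz : z ∈ U) {w : E → ℝ}
    (hw : ∀ v, 0 ≤ w v) {f g : E → ℂ} (hf : ContDiffOn ℝ (⊤ : ℕ∞) f U)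
    (hg : ContDiffOn ℝ (⊤ : ℕ∞) g U)
    (hfz : ‖Complex.exp (f z)‖ ≤ 1)
    (hfg : ‖Complex.exp (f z) - Complex.exp (g z)‖ ≤ ‖f z - g z‖)
    {A B : ℝ} (hA : 1 ≤ A) (hB : 0 ≤ B) (m : ℕ) :
    ∀ L : List E, L.length ≤ m →
      (∀ S, S.Sublist L → S ≠ [] → ‖dirDs S f z‖ ≤ A * (S.map w).prod) →
      (∀ S, S.Sublist L → S ≠ [] → ‖dirDs S g z‖ ≤ A * (S.map w).prod) →
      (∀ S, S.Sublist L → ‖dirDs S (fun x => f x - g x) z‖ ≤ B * (S.map w).prod) →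
      ‖dirDs L (fun x => Complex.exp (f x) - Complex.exp (g x)) z‖ ≤
        (2 ^ (m + 1) * A) ^ m * B * (L.map w).prod := by
  induction m with
  | zero =>
    intro L hL _ _ hS
    obtain rfl : L = [] := by simpa using hL
    have := hS [] (List.Sublist.refl _)
    simp only [dirDs, List.foldr_nil, List.map_nil, List.prod_nil, mul_one, pow_zero, one_mul]
      at this ⊢
    exact hfg.trans this
  | succ m ih =>
    intro L hL hSf hSg hS
    have h2A : (1 : ℝ) ≤ 2 ^ (m + 1 + 1) * A := one_le_mul_of_one_le_of_one_le
      (one_le_pow₀ (by norm_num)) hA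
    rcases List.eq_nil_or_concat L with rfl | ⟨L, v, rfl⟩
    · have := hS [] (List.Sublist.refl _)
      simp only [dirDs, List.foldr_nil, List.map_nil, List.prod_nil, mul_one] at this ⊢
      exact hfg.trans (this.trans (le_mul_of_one_le_left hB (one_le_pow₀ h2A)))
    · rw [List.concat_eq_append] at *
      have hL' : L.length ≤ m := by simpa using hL
      have hLv : L.Sublist (L ++ [v]) := List.sublist_append_left _ _
      have hv : ∀ {f : E → ℂ} {a : ℝ},
          (∀ S, S.Sublist (L ++ [v]) → S ≠ [] → ‖dirDs S f z‖ ≤ a * (S.map w).prod) →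
          ∀ S, S.Sublist L → ‖dirDs S (dirD v f) z‖ ≤ (a * w v) * (S.map w).prod := by
        intro f a h S hS
        have := h (S ++ [v]) (hS.append_right [v]) (by simp)
        rw [dirDs_append] at this
        refine this.trans_eq ?_
        simp
        ring
      have h1 := norm_dirDs_mul_le hU hz w L ((hf.sub hg).dirD hU v) hf.cexp (a := B * w v)
        (b := (2 ^ m * A) ^ m) (hv fun S hSL _ => hS S hSL) (by
          intro S hSL
          exact norm_dirDs_cexp_le hU hz hw hf hfz hA m S (hSL.length_le.trans hL')
            fun T hT => hSf T (hT.trans (hSL.trans hLv)))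
      have h2 := norm_dirDs_mul_le hU hz w L (hg.dirD hU v) (hf.cexp.sub hg.cexp) (a := A * w v)
        (b := (2 ^ (m + 1) * A) ^ m * B) (hv hSg) (by
          intro S hSL
          exact ih S (hSL.length_le.trans hL')
            (fun T hT => hSf T (hT.trans (hSL.trans hLv)))
            (fun T hT => hSg T (hT.trans (hSL.trans hLv)))
            (fun T hT => hS T (hT.trans (hSL.trans hLv))))
      have hD : EqOn (dirD v (fun x => Complex.exp (f x) - Complex.exp (g x)))
          (fun x => dirD v (fun x => f x - g x) x * Complex.exp (f x) +
            dirD v g x * (Complex.exp (f x) - Complex.exp (g x))) U := by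
        intro x hx
        have e1 := dirD_cexp hU hf v hx
        have e2 := dirD_cexp hU hg v hx
        simp only [dirD] at e1 e2 ⊢
        rw [fderiv_fun_sub (differentiableAt_of_contDiffOn_top hU hf.cexp hx)
          (differentiableAt_of_contDiffOn_top hU hg.cexp hx),
          fderiv_fun_sub (differentiableAt_of_contDiffOn_top hU hf hx)
          (differentiableAt_of_contDiffOn_top hU hg hx)]
        simp only [sub_apply, e1, e2]
        ring
      have h3 := (dirDs_congr hU hD L hz).trans (dirDs_add hU
        (((hf.sub hg).dirD hU v).mul hf.cexp) ((hg.dirD hU v).mul (hf.cexp.sub hg.cexp)) L hz)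
      rw [dirDs_append]
      change ‖dirDs L (dirD v fun x => Complex.exp (f x) - Complex.exp (g x)) z‖ ≤ _
      rw [h3]
      refine (norm_add_le _ _).trans ((add_le_add h1 h2).trans ?_)
      have hW := mul_nonneg (list_map_prod_nonneg hw L) (hw v)
      have hc : 2 ^ L.length * (B * (2 ^ m * A) ^ m) +
          2 ^ L.length * (A * ((2 ^ (m + 1) * A) ^ m * B)) ≤
          (2 ^ (m + 1 + 1) * A) ^ (m + 1) * B := by
        calc _ ≤ 2 ^ (m + 1) * ((A * B) * (2 ^ (m + 1 + 1) * A) ^ m) +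
            2 ^ (m + 1) * (A * ((2 ^ (m + 1 + 1) * A) ^ m * B)) := by
              gcongr <;> first | omega | exact le_mul_of_one_le_left hB hA | norm_num
          _ = _ := by ring
      calc _ = (2 ^ L.length * (B * (2 ^ m * A) ^ m) +
          2 ^ L.length * (A * ((2 ^ (m + 1) * A) ^ m * B))) * ((L.map w).prod * w v) := by ring
        _ ≤ (2 ^ (m + 1 + 1) * A) ^ (m + 1) * B * ((L.map w).prod * w v) := by gcongr
        _ = _ := by simp

end DirectionalDerivatives

section PhaseFunctions

variable {n p : ℕ}

lemma one_le_jb (ξ : Euc p) : 1 ≤ jb ξ := by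
  rw [jb, Real.one_le_sqrt]
  nlinarith [sq_nonneg ‖ξ‖]

lemma norm_le_jb (ξ : Euc p) : ‖ξ‖ ≤ jb ξ :=
  Real.le_sqrt_of_sq_le (by linarith)

lemma isOpen_prod_ne_zero {Ω : Set (Euc n)} (hΩ : IsOpen Ω) :
    IsOpen (Ω ×ˢ {ξ : Euc p | ξ ≠ 0}) :=
  hΩ.prod isOpen_ne

lemma exists_of_sublist_map_eXi_append_map_eY {α : List (Fin p)} {β : List (Fin n)}
    {S : List (Euc n × Euc p)} (h : S.Sublist (α.map eXi ++ β.map eY)) :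
    ∃ (α' : List (Fin p)) (β' : List (Fin n)), α'.Sublist α ∧ β'.Sublist β ∧ S = α'.map eXi ++ β'.map eY := by
  obtain ⟨S₁, S₂, rfl, h₁, h₂⟩ := List.sublist_append_iff.1 h
  obtain ⟨α', hα, rfl⟩ := List.sublist_map_iff.1 h₁
  obtain ⟨β', hβ, rfl⟩ := List.sublist_map_iff.1 h₂
  exact ⟨α', β', hα, hβ, rfl⟩

lemma finite_setOf_sublist {ι κ : Type*} (α : List ι) (β : List κ) :
    {x : List ι × List κ | x.1.Sublist α ∧ x.2.Sublist β}.Finite := by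
  refine ((List.finite_toSet α.sublists).prod (List.finite_toSet β.sublists)).subset ?_
  rintro ⟨α', β'⟩ ⟨hα, hβ⟩
  exact ⟨List.mem_sublists.2 hα, List.mem_sublists.2 hβ⟩

/-- The weight of a direction: `1` for `ξ`-directions, `r` for `y`-directions. -/
def dirWeight (r : ℝ) (v : Euc n × Euc p) : ℝ := ‖v.2‖ + r * ‖v.1‖

lemma prod_map_dirWeight (r : ℝ) (α : List (Fin p)) (β : List (Fin n)) :
    ((α.map (eXi (n := n)) ++ β.map eY).map (dirWeight r)).prod = r ^ β.length := by
  have h1 : dirWeight r ∘ (eXi (n := n) (p := p)) = fun _ => 1 := by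
    funext j; simp [dirWeight, eXi]
  have h2 : dirWeight r ∘ (eY (n := n) (p := p)) = fun _ => r := by
    funext j; simp [dirWeight, eY]
  simp [h1, h2]

lemma fderiv_of_homogeneous {U : Set (Euc n × Euc p)} (hU : IsOpen U)
    {f : Euc n × Euc p → ℝ} (hf : ContDiffOn ℝ (⊤ : ℕ∞) f U) {t c : ℝ}
    (hUt : ∀ z ∈ U, (z.1, t • z.2) ∈ U)
    (h : ∀ z ∈ U, f (z.1, t • z.2) = c * f z) {z : Euc n × Euc p} (hz : z ∈ U)
    (v : Euc n × Euc p) :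
    fderiv ℝ f (z.1, t • z.2) (v.1, t • v.2) = c * dirD v f z := by
  let T : Euc n × Euc p →L[ℝ] Euc n × Euc p :=
    (ContinuousLinearMap.fst ℝ _ _).prod (t • ContinuousLinearMap.snd ℝ _ _)
  have h1 : HasFDerivAt (fun z => f (T z)) ((fderiv ℝ f (T z)).comp T) z :=
    (differentiableAt_of_contDiffOn_top hU hf (hUt z hz)).hasFDerivAt.comp z T.hasFDerivAt
  have h2 : HasFDerivAt (fun z => c * f z) (c • fderiv ℝ f z) z :=
    (differentiableAt_of_contDiffOn_top hU hf hz).hasFDerivAt.const_mul c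
  have h3 : (fun z => f (T z)) =ᶠ[𝓝 z] fun z => c * f z :=
    Filter.eventuallyEq_of_mem (hU.mem_nhds hz) h
  have h4 := congrArg (fun L : Euc n × Euc p →L[ℝ] ℝ => L v) ((h2.congr_of_eventuallyEq h3).unique h1)
  exact h4.symm

lemma dirDs_of_homogeneous {Ω : Set (Euc n)} (hΩ : IsOpen Ω) {f : Euc n × Euc p → ℝ}
    (hf : ContDiffOn ℝ (⊤ : ℕ∞) f (Ω ×ˢ {ξ : Euc p | ξ ≠ 0})) {t c : ℝ} (ht : 0 < t)
    (h : ∀ z ∈ Ω ×ˢ {ξ : Euc p | ξ ≠ 0}, f (z.1, t • z.2) = c * f z)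
    (α : List (Fin p)) (β : List (Fin n)) :
    ∀ z ∈ Ω ×ˢ {ξ : Euc p | ξ ≠ 0}, dirDs (α.map eXi ++ β.map eY) f (z.1, t • z.2) =
      c * t⁻¹ ^ α.length * dirDs (α.map eXi ++ β.map eY) f z := by
  have hU := isOpen_prod_ne_zero (p := p) hΩ
  have hUt : ∀ z ∈ Ω ×ˢ {ξ : Euc p | ξ ≠ 0}, (z.1, t • z.2) ∈ Ω ×ˢ {ξ : Euc p | ξ ≠ 0} :=
    fun z hz => ⟨hz.1, smul_ne_zero ht.ne' hz.2⟩
  induction α with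
  | nil =>
    induction β with
    | nil => simpa [dirDs] using h
    | cons k β ih =>
      intro z hz
      have := fderiv_of_homogeneous hU (hf.dirDs hU _) hUt ih hz (eY k)
      simpa [dirDs, dirD, eY] using this
  | cons j α ih =>
    intro z hz
    have := fderiv_of_homogeneous hU (hf.dirDs hU _) hUt ih hz (eXi j)
    have he : ((eXi j : Euc n × Euc p).1, t • (eXi j : Euc n × Euc p).2) = t • eXi j := by
      simp [eXi]
    rw [he, map_smul, smul_eq_mul] at this
    rw [List.length_cons, pow_succ]
    change fderiv ℝ (dirDs (α.map eXi ++ β.map eY) f) (z.1, t • z.2) (eXi j) =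
      c * (t⁻¹ ^ α.length * t⁻¹) * dirD (eXi j) (dirDs (α.map eXi ++ β.map eY) f) z
    field_simp at this ⊢
    linarith

lemma exists_bound_dirDs_of_homogeneous {Ω : Set (Euc n)} (hΩ : IsOpen Ω)
    {f : Euc n × Euc p → ℝ} (hf : ContDiffOn ℝ (⊤ : ℕ∞) f (Ω ×ˢ {ξ : Euc p | ξ ≠ 0}))
    (h : ∀ y ∈ Ω, ∀ ξ : Euc p, ξ ≠ 0 → ∀ t : ℝ, 0 < t → f (y, t • ξ) = t * f (y, ξ))
    {K : Set (Euc n)} (hKΩ : K ⊆ Ω) (hK : IsCompact K) (α : List (Fin p)) (β : List (Fin n)) :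
    ∃ C : ℝ, ∀ y ∈ K, ∀ ξ : Euc p, ξ ≠ 0 →
      ‖dirDs (α.map eXi ++ β.map eY) f (y, ξ)‖ ≤ C * (‖ξ‖ * ‖ξ‖⁻¹ ^ α.length) := by
  have hU := isOpen_prod_ne_zero (p := p) hΩ
  have hcont := (hf.dirDs hU (α.map eXi ++ β.map eY)).continuousOn
  have hcpt : IsCompact (K ×ˢ Metric.sphere (0 : Euc p) 1) := hK.prod (isCompact_sphere _ _)
  obtain ⟨C, hC⟩ := hcpt.exists_bound_of_continuousOn (hcont.mono (by
    rintro ⟨y, ξ⟩ ⟨hy, hξ⟩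
    exact ⟨hKΩ hy, ne_zero_of_mem_unit_sphere (⟨ξ, hξ⟩ : Metric.sphere (0 : Euc p) 1)⟩))
  refine ⟨C, fun y hy ξ hξ => ?_⟩
  have hpos : 0 < ‖ξ‖ := norm_pos_iff.2 hξ
  have hmem : (y, ‖ξ‖⁻¹ • ξ) ∈ K ×ˢ Metric.sphere (0 : Euc p) 1 := by
    refine ⟨hy, ?_⟩
    simp [norm_smul, hpos.ne']
  have h1 := dirDs_of_homogeneous hΩ hf hpos (fun z hz => h z.1 hz.1 z.2 hz.2 _ hpos) α β
    (y, ‖ξ‖⁻¹ • ξ) ⟨hKΩ hy, smul_ne_zero (inv_ne_zero hpos.ne') hξ⟩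
  rw [smul_inv_smul₀ hpos.ne'] at h1
  rw [h1, norm_mul, mul_comm C]
  have h2 : ‖‖ξ‖ * ‖ξ‖⁻¹ ^ α.length‖ = ‖ξ‖ * ‖ξ‖⁻¹ ^ α.length := by
    rw [Real.norm_of_nonneg]
    positivity
  rw [h2]
  exact mul_le_mul_of_nonneg_left (hC _ hmem) (by positivity)

lemma mul_inv_pow_le {s c r : ℝ} (hc : 0 < c) (hc1 : c ≤ 1) (hcs : c ≤ s) (hsr : s ≤ r)
    {k m : ℕ} (hkm : k ≤ m) : s * s⁻¹ ^ k ≤ c⁻¹ ^ m * r := by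
  have hs : 0 < s := hc.trans_le hcs
  have h1 : s⁻¹ ^ k ≤ c⁻¹ ^ m := by
    calc s⁻¹ ^ k ≤ c⁻¹ ^ k := by gcongr
      _ ≤ c⁻¹ ^ m := pow_le_pow_right₀ ((one_le_inv₀ hc).2 hc1) hkm
  rw [mul_comm]
  gcongr

lemma mul_inv_pow_succ_le {s c : ℝ} (hc : 0 < c) (hc1 : c ≤ 1) (hcs : c ≤ s)
    {k m : ℕ} (hkm : k ≤ m) : s * s⁻¹ ^ (k + 1) ≤ c⁻¹ ^ m := by
  have hs : 0 < s := hc.trans_le hcs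
  have h1 : s * s⁻¹ ^ (k + 1) = s⁻¹ ^ k := by
    rw [pow_succ]
    field_simp
  calc s * s⁻¹ ^ (k + 1) = s⁻¹ ^ k := h1
    _ ≤ c⁻¹ ^ k := by gcongr
    _ ≤ c⁻¹ ^ m := pow_le_pow_right₀ ((one_le_inv₀ hc).2 hc1) hkm

lemma norm_cexp_I_mul_sub_le (a b : ℝ) :
    ‖Complex.exp (Complex.I * (a : ℂ)) - Complex.exp (Complex.I * (b : ℂ))‖ ≤ ‖a - b‖ := by
  have h : Complex.exp (Complex.I * (a : ℂ)) - Complex.exp (Complex.I * (b : ℂ)) =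
      Complex.exp ((b : ℂ) * Complex.I) * (Complex.exp (Complex.I * ((a - b : ℝ) : ℂ)) - 1) := by
    rw [mul_sub, ← Complex.exp_add]
    push_cast
    ring_nf
  rw [h, norm_mul, Complex.norm_exp_ofReal_mul_I, one_mul]
  exact Real.norm_exp_I_mul_ofReal_sub_one_le

/-- Quantitative estimate for the derivatives of `e^{iφ} - e^{iω}` in terms of bounds on the
derivatives of `φ`, `ω` and `φ - ω`. -/
lemma norm_dirDs_cexp_I_sub_le {Ω : Set (Euc n)} (hΩ : IsOpen Ω) {φ ω : Euc n × Euc p → ℝ}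
    (hφ : ContDiffOn ℝ (⊤ : ℕ∞) φ (Ω ×ˢ {ξ : Euc p | ξ ≠ 0}))
    (hω : ContDiffOn ℝ (⊤ : ℕ∞) ω (Ω ×ˢ {ξ : Euc p | ξ ≠ 0}))
    {y : Euc n} (hy : y ∈ Ω) {ξ : Euc p} {c : ℝ} (hc : 0 < c) (hc1 : c ≤ 1) (hcξ : c ≤ ‖ξ‖)
    (α : List (Fin p)) (β : List (Fin n)) {A B : ℝ} (hA : 1 ≤ A) (hB : 0 ≤ B)
    (hAφ : ∀ (α' : List (Fin p)) (β' : List (Fin n)), α'.Sublist α → β'.Sublist β →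
      ‖dirDs (α'.map eXi ++ β'.map eY) φ (y, ξ)‖ ≤ A * (‖ξ‖ * ‖ξ‖⁻¹ ^ α'.length))
    (hAω : ∀ (α' : List (Fin p)) (β' : List (Fin n)), α'.Sublist α → β'.Sublist β →
      ‖dirDs (α'.map eXi ++ β'.map eY) ω (y, ξ)‖ ≤ A * (‖ξ‖ * ‖ξ‖⁻¹ ^ α'.length))
    (hBφω : ∀ (α' : List (Fin p)) (β' : List (Fin n)), α'.Sublist α → β'.Sublist β →
      ‖dirDs (α'.map eXi ++ β'.map eY) (fun z => φ z - ω z) (y, ξ)‖ ≤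
        B * (‖ξ‖ * ‖ξ‖⁻¹ ^ α'.length)) :
    jb ξ ^ (-1 + 0 * (α.length : ℝ) - 1 * (β.length : ℝ)) *
      ‖dirDs (α.map eXi ++ β.map eY) (fun z => Complex.exp (Complex.I * ((φ z : ℝ) : ℂ)) -
        Complex.exp (Complex.I * ((ω z : ℝ) : ℂ))) (y, ξ)‖ ≤
      (2 ^ (α.length + β.length + 1) * (A * c⁻¹ ^ (α.length + β.length))) ^
        (α.length + β.length) * (B * c⁻¹ ^ (α.length + β.length)) := by
  have hU := isOpen_prod_ne_zero (p := p) hΩ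
  have hξ : ξ ≠ 0 := norm_pos_iff.1 (hc.trans_le hcξ)
  have hz : (y, ξ) ∈ Ω ×ˢ {ξ : Euc p | ξ ≠ 0} := ⟨hy, hξ⟩
  have hr := one_le_jb ξ
  set m := α.length + β.length with hm
  have hcm : 1 ≤ c⁻¹ ^ m := one_le_pow₀ ((one_le_inv₀ hc).2 hc1)
  let T : ℝ →L[ℝ] ℂ := Complex.I • Complex.ofRealCLM
  have hT : ∀ {g : Euc n × Euc p → ℝ}, ContDiffOn ℝ (⊤ : ℕ∞) g (Ω ×ˢ {ξ : Euc p | ξ ≠ 0}) →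
      ContDiffOn ℝ (⊤ : ℕ∞) (fun z => Complex.I * ((g z : ℝ) : ℂ))
        (Ω ×ˢ {ξ : Euc p | ξ ≠ 0}) :=
    fun hg => T.contDiff.comp_contDiffOn hg
  have hTn : ∀ {g : Euc n × Euc p → ℝ}, ContDiffOn ℝ (⊤ : ℕ∞) g (Ω ×ˢ {ξ : Euc p | ξ ≠ 0}) →
      ∀ S, ‖dirDs S (fun z => Complex.I * ((g z : ℝ) : ℂ)) (y, ξ)‖ = ‖dirDs S g (y, ξ)‖ := by
    intro g hg S
    have := dirDs_clm_comp hU hg T S hz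
    change dirDs S (fun z => Complex.I * ((g z : ℝ) : ℂ)) (y, ξ) = _ at this
    rw [this]
    simp [T]
  have hnonempty : ∀ {g : Euc n × Euc p → ℝ},
      ContDiffOn ℝ (⊤ : ℕ∞) g (Ω ×ˢ {ξ : Euc p | ξ ≠ 0}) →
      (∀ (α' : List (Fin p)) (β' : List (Fin n)), α'.Sublist α → β'.Sublist β →
        ‖dirDs (α'.map eXi ++ β'.map eY) g (y, ξ)‖ ≤ A * (‖ξ‖ * ‖ξ‖⁻¹ ^ α'.length)) →
      ∀ S : List (Euc n × Euc p), S.Sublist (α.map eXi ++ β.map eY) → S ≠ [] →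
        ‖dirDs S (fun z => Complex.I * ((g z : ℝ) : ℂ)) (y, ξ)‖ ≤
          A * c⁻¹ ^ m * (S.map (dirWeight (jb ξ))).prod := by
    intro g hg hAg S hS hS0
    obtain ⟨α', β', hα, hβ, rfl⟩ := exists_of_sublist_map_eXi_append_map_eY hS
    rw [hTn hg, prod_map_dirWeight, mul_assoc]
    refine (hAg α' β' hα hβ).trans (mul_le_mul_of_nonneg_left ?_ (zero_le_one.trans hA))
    have hαm : α'.length ≤ m := hα.length_le.trans (by omega)
    rcases β' with _ | ⟨k, β'⟩
    · rcases α' with _ | ⟨j, α'⟩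
      · simp at hS0
      · simp only [List.length_nil, pow_zero, mul_one]
        refine mul_inv_pow_succ_le hc hc1 hcξ ?_
        simp at hαm
        omega
    · exact mul_inv_pow_le hc hc1 hcξ
        ((norm_le_jb ξ).trans (le_self_pow₀ hr (by simp))) hαm
  have hsub : (fun z => Complex.I * ((φ z : ℝ) : ℂ) - Complex.I * ((ω z : ℝ) : ℂ)) =
      fun z => Complex.I * ((φ z - ω z : ℝ) : ℂ) := by
    funext z
    push_cast
    ring
  have key := norm_dirDs_cexp_sub_cexp_le hU hz (w := dirWeight (jb ξ))
    (fun v => by unfold dirWeight; positivity) (hT hφ) (hT hω)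
    (by rw [mul_comm, Complex.norm_exp_ofReal_mul_I]) (by
      rw [← mul_sub, norm_mul, Complex.norm_I, one_mul, ← Complex.ofReal_sub, Complex.norm_real]
      exact norm_cexp_I_mul_sub_le _ _)
    (one_le_mul_of_one_le_of_one_le hA hcm) (B := B * c⁻¹ ^ m * jb ξ) (by positivity)
    m (α.map eXi ++ β.map eY) (by simp [hm]) (hnonempty hφ hAφ) (hnonempty hω hAω) (by
      intro S hS
      obtain ⟨α', β', hα, hβ, rfl⟩ := exists_of_sublist_map_eXi_append_map_eY hS
      rw [hsub, hTn (hφ.sub hω), prod_map_dirWeight, mul_assoc, mul_assoc]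
      refine (hBφω α' β' hα hβ).trans (mul_le_mul_of_nonneg_left ?_ hB)
      refine mul_inv_pow_le hc hc1 hcξ ?_ (hα.length_le.trans (by omega))
      exact (norm_le_jb ξ).trans (le_mul_of_one_le_right (by positivity) (one_le_pow₀ hr)))
  rw [prod_map_dirWeight] at key
  have hpow : jb ξ ^ (-1 + 0 * (α.length : ℝ) - 1 * (β.length : ℝ)) =
      (jb ξ * jb ξ ^ β.length)⁻¹ := by
    have : (-1 + 0 * (α.length : ℝ) - 1 * (β.length : ℝ)) = -((β.length + 1 : ℕ) : ℝ) := by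
      push_cast
      ring
    rw [this, Real.rpow_neg (by positivity), Real.rpow_natCast, pow_succ']
  rw [hpow, inv_mul_le_iff₀ (by positivity)]
  refine key.trans_eq ?_
  ring

lemma le_mul_of_rpow_mul_le {s x M : ℝ} (hs : 0 < s) {k : ℕ}
    (h : s ^ (-1 + (k : ℝ)) * x ≤ M) : x ≤ M * (s * s⁻¹ ^ k) := by
  rw [Real.rpow_add hs, Real.rpow_neg_one, Real.rpow_natCast] at h
  calc x = s⁻¹ * s ^ k * x * (s * s⁻¹ ^ k) := by
        rw [inv_pow]
        field_simp
    _ ≤ M * (s * s⁻¹ ^ k) := by gcongr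

lemma HgModerate.eventually {Ω : Set (Euc n)} {φ : ℝ → Euc n × Euc p → ℝ}
    (h : HgModerate Ω 1 φ) {K : Set (Euc n)} (hKΩ : K ⊆ Ω) (hK : IsCompact K)
    (α : List (Fin p)) (β : List (Fin n)) :
    ∃ N : ℕ, ∀ᶠ ε in 𝓝[>] (0 : ℝ), ∀ (α' : List (Fin p)) (β' : List (Fin n)), α'.Sublist α → β'.Sublist β → ∀ y ∈ K,
      ∀ ξ : Euc p, ξ ≠ 0 → ‖dirDs (α'.map eXi ++ β'.map eY) (φ ε) (y, ξ)‖ ≤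
        ε⁻¹ ^ N * (‖ξ‖ * ‖ξ‖⁻¹ ^ α'.length) := by
  choose N C hC η hη hb using h K hKΩ hK
  have hfin := finite_setOf_sublist α β
  obtain ⟨M, hM⟩ := (hfin.image fun x => N x.1 x.2).bddAbove
  refine ⟨M + 1, ?_⟩
  have : ∀ᶠ ε in 𝓝[>] (0 : ℝ), ∀ x ∈ {x : List (Fin p) × List (Fin n) |
      x.1.Sublist α ∧ x.2.Sublist β}, ε ∈ Ioc 0 (min (η x.1 x.2) (C x.1 x.2)⁻¹) :=
    (Filter.eventually_all_finite hfin).2 fun x _ =>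
      Ioc_mem_nhdsGT (lt_min (hη _ _).1 (inv_pos.2 (hC _ _)))
  filter_upwards [this] with ε hε α' β' hα hβ y hy ξ hξ
  obtain ⟨h0, h1⟩ := hε (α', β') ⟨hα, hβ⟩
  have h1' := h1.trans (min_le_left _ _)
  have h2 : C α' β' ≤ ε⁻¹ := (le_inv_comm₀ h0 (hC _ _)).1 (h1.trans (min_le_right _ _))
  have h3 := hb α' β' ε ⟨h0, h1'⟩ y hy ξ hξ
  have hNM : N α' β' ≤ M := hM ⟨(α', β'), ⟨hα, hβ⟩, rfl⟩
  have hε1 : 1 ≤ ε⁻¹ := (one_le_inv₀ h0).2 (h1'.trans (hη _ _).2)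
  refine le_mul_of_rpow_mul_le (norm_pos_iff.2 hξ) (h3.trans ?_)
  rw [zpow_neg, zpow_natCast, ← inv_pow, pow_succ']
  gcongr

lemma HgNegligible.eventually {Ω : Set (Euc n)} {φ : ℝ → Euc n × Euc p → ℝ}
    (h : HgNegligible Ω 1 φ) {K : Set (Euc n)} (hKΩ : K ⊆ Ω) (hK : IsCompact K)
    (α : List (Fin p)) (β : List (Fin n)) (q : ℕ) :
    ∀ᶠ ε in 𝓝[>] (0 : ℝ), ∀ (α' : List (Fin p)) (β' : List (Fin n)), α'.Sublist α → β'.Sublist β → ∀ y ∈ K,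
      ∀ ξ : Euc p, ξ ≠ 0 → ‖dirDs (α'.map eXi ++ β'.map eY) (φ ε) (y, ξ)‖ ≤
        ε ^ q * (‖ξ‖ * ‖ξ‖⁻¹ ^ α'.length) := by
  choose C hC η hη hb using fun α β => h K hKΩ hK α β (q + 1)
  have hfin := finite_setOf_sublist α β
  have : ∀ᶠ ε in 𝓝[>] (0 : ℝ), ∀ x ∈ {x : List (Fin p) × List (Fin n) |
      x.1.Sublist α ∧ x.2.Sublist β}, ε ∈ Ioc 0 (min (η x.1 x.2) (C x.1 x.2)⁻¹) :=
    (Filter.eventually_all_finite hfin).2 fun x _ =>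
      Ioc_mem_nhdsGT (lt_min (hη _ _).1 (inv_pos.2 (hC _ _)))
  filter_upwards [this] with ε hε α' β' hα hβ y hy ξ hξ
  obtain ⟨h0, h1⟩ := hε (α', β') ⟨hα, hβ⟩
  have h2 : C α' β' * ε ≤ 1 := by
    have := mul_le_mul_of_nonneg_left (h1.trans (min_le_right _ _)) (hC α' β').le
    rwa [mul_inv_cancel₀ (hC α' β').ne'] at this
  have h3 := hb α' β' ε ⟨h0, h1.trans (min_le_left _ _)⟩ y hy ξ hξ
  refine le_mul_of_rpow_mul_le (norm_pos_iff.2 hξ) (h3.trans ?_)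
  calc C α' β' * ε ^ (q + 1) = C α' β' * ε * ε ^ q := by ring
    _ ≤ 1 * ε ^ q := by gcongr
    _ = ε ^ q := one_mul _

/-- Homogeneous smooth functions satisfy uniform bounds for finitely many derivatives. -/
lemma exists_bound_sublist_of_homogeneous {Ω : Set (Euc n)} (hΩ : IsOpen Ω)
    {f : Euc n × Euc p → ℝ} (hf : ContDiffOn ℝ (⊤ : ℕ∞) f (Ω ×ˢ {ξ : Euc p | ξ ≠ 0}))
    (h : ∀ y ∈ Ω, ∀ ξ : Euc p, ξ ≠ 0 → ∀ t : ℝ, 0 < t → f (y, t • ξ) = t * f (y, ξ))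
    {K : Set (Euc n)} (hKΩ : K ⊆ Ω) (hK : IsCompact K) (α : List (Fin p)) (β : List (Fin n)) :
    ∃ M : ℝ, 1 ≤ M ∧ ∀ C, M ≤ C → ∀ (α' : List (Fin p)) (β' : List (Fin n)), α'.Sublist α → β'.Sublist β → ∀ y ∈ K,
      ∀ ξ : Euc p, ξ ≠ 0 → ‖dirDs (α'.map eXi ++ β'.map eY) f (y, ξ)‖ ≤
        C * (‖ξ‖ * ‖ξ‖⁻¹ ^ α'.length) := by
  choose C hC using exists_bound_dirDs_of_homogeneous hΩ hf h hKΩ hK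
  obtain ⟨M, hM⟩ := ((finite_setOf_sublist α β).image fun x => C x.1 x.2).bddAbove
  refine ⟨max 1 M, le_max_left _ _, fun D hD α' β' hα hβ y hy ξ hξ =>
    (hC α' β' y hy ξ hξ).trans ?_⟩
  have : C α' β' ≤ D :=
    (hM ⟨(α', β'), ⟨hα, hβ⟩, rfl⟩ : C α' β' ≤ M).trans ((le_max_right _ _).trans hD)
  gcongr

lemma exists_pos_le_norm_snd {Ω : Set (Euc n)} {K : Set (Euc n × Euc p)}
    (hKΩ : K ⊆ Ω ×ˢ {ξ : Euc p | ξ ≠ 0}) (hK : IsCompact K) :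
    ∃ c : ℝ, 0 < c ∧ c ≤ 1 ∧ ∀ z ∈ K, ∀ t : ℝ, 1 ≤ t → c ≤ ‖t • z.2‖ := by
  obtain ⟨c, hc, hcK⟩ : ∃ c : ℝ, 0 < c ∧ ∀ z ∈ K, c ≤ ‖z.2‖ := by
    rcases K.eq_empty_or_nonempty with rfl | hne
    · exact ⟨1, one_pos, by simp⟩
    · obtain ⟨z, hz, hmin⟩ := hK.exists_isMinOn hne
        (continuous_snd.norm.continuousOn (s := K))
      exact ⟨‖z.2‖, norm_pos_iff.2 (hKΩ hz).2, fun x hx => hmin hx⟩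
  refine ⟨min c 1, lt_min hc one_pos, min_le_right _ _, fun z hz t ht => ?_⟩
  rw [norm_smul, Real.norm_of_nonneg (zero_le_one.trans ht)]
  exact (min_le_left _ _).trans ((hcK z hz).trans (le_mul_of_one_le_left (norm_nonneg _) ht))

end PhaseFunctions

/-- Proposition on e^{iφ}, equivalence part: if (φ_ε) ∼ (ω_ε) in M_Φ(Ω×ℝ^p)
then sup_{y∈K,ξ≠0}|ξ|⁻¹|e^{iφ_ε}−e^{iω_ε}| = O(ε^q) for all q, and the net
(e^{iφ_ε}−e^{iω_ε})_ε is negligible in S^1_{0,1}(Ω×(ℝ^p∖0)). -/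
theorem stmt7 {n p : ℕ} (Ω : Set (Euc n)) (hΩ : IsOpen Ω)
    (φ ω : ℝ → Euc n × Euc p → ℝ) (hφ : MPhi Ω φ) (hω : MPhi Ω ω)
    (hdiff : HgNegligible Ω 1 (fun ε z => φ ε z - ω ε z)) :
    (∀ K ⊆ Ω, IsCompact K → ∀ q : ℕ, ∃ C > 0, ∃ η ∈ Set.Ioc (0:ℝ) 1,
      ∀ ε ∈ Set.Ioc (0:ℝ) η, ∀ y ∈ K, ∀ ξ : Euc p, ξ ≠ 0 →
        ‖ξ‖⁻¹ * ‖Complex.exp (Complex.I * ((φ ε (y, ξ) : ℝ) : ℂ)) -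
            Complex.exp (Complex.I * ((ω ε (y, ξ) : ℝ) : ℂ))‖ ≤ C * ε ^ q) ∧
    ConicNegligible Ω 1 0 1
      (fun ε z => Complex.exp (Complex.I * ((φ ε z : ℝ) : ℂ)) -
        Complex.exp (Complex.I * ((ω ε z : ℝ) : ℂ))) := by
  refine ⟨fun K hKΩ hK q => ?_, ?_, ?_, ?_⟩
  · obtain ⟨C, hC, η, hη, h⟩ := hdiff K hKΩ hK [] [] q
    refine ⟨C, hC, η, hη, fun ε hε y hy ξ hξ => le_trans ?_ (h ε hε y hy ξ hξ)⟩
    simp only [List.length_nil, Nat.cast_zero, add_zero, Real.rpow_neg_one]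
    exact mul_le_mul_of_nonneg_left (norm_cexp_I_mul_sub_le _ _) (by positivity)
  · intro ε hε
    have hsm : ∀ {g : Euc n × Euc p → ℝ},
        ContDiffOn ℝ (⊤ : ℕ∞) g (Ω ×ˢ {ξ : Euc p | ξ ≠ 0}) →
        ContDiffOn ℝ (⊤ : ℕ∞) (fun z => Complex.exp (Complex.I * ((g z : ℝ) : ℂ)))
          (Ω ×ˢ {ξ : Euc p | ξ ≠ 0}) := fun hg =>
      (contDiffOn_const.mul (Complex.ofRealCLM.contDiff.comp_contDiffOn hg)).cexp
    exact (hsm (hφ.1 ε hε).1).sub (hsm (hω.1 ε hε).1)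
  · intro ε hε K hKΩ hK α β
    obtain ⟨c, hc, hc1, hcK⟩ := exists_pos_le_norm_snd hKΩ hK
    have hK' : IsCompact (Prod.fst '' K) := hK.image continuous_fst
    have hKΩ' : Prod.fst '' K ⊆ Ω := by
      rintro _ ⟨z, hz, rfl⟩
      exact (hKΩ hz).1
    obtain ⟨hφs, hφh, -⟩ := hφ.1 ε hε
    obtain ⟨hωs, hωh, -⟩ := hω.1 ε hε
    obtain ⟨M₁, hM₁, h₁⟩ := exists_bound_sublist_of_homogeneous hΩ hφs hφh hKΩ' hK' α β
    obtain ⟨M₂, -, h₂⟩ := exists_bound_sublist_of_homogeneous hΩ hωs hωh hKΩ' hK' α β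
    obtain ⟨M₃, hM₃, h₃⟩ := exists_bound_sublist_of_homogeneous hΩ (hφs.sub hωs)
      (fun y hy ξ hξ t ht => by
        simp only [hφh y hy ξ hξ t ht, hωh y hy ξ hξ t ht]; ring) hKΩ' hK' α β
    refine ⟨_, fun z hz t ht => norm_dirDs_cexp_I_sub_le hΩ hφs hωs (hKΩ hz).1 hc hc1
      (hcK z hz t ht) α β (A := max M₁ M₂) (B := M₃) (hM₁.trans (le_max_left _ _))
      (zero_le_one.trans hM₃)
      (fun α' β' hα hβ => h₁ _ (le_max_left _ _) α' β' hα hβ _ ⟨z, hz, rfl⟩ _ ?_)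
      (fun α' β' hα hβ => h₂ _ (le_max_right _ _) α' β' hα hβ _ ⟨z, hz, rfl⟩ _ ?_)
      (fun α' β' hα hβ => h₃ _ le_rfl α' β' hα hβ _ ⟨z, hz, rfl⟩ _ ?_)⟩
    all_goals exact norm_pos_iff.1 (hc.trans_le (hcK z hz t ht))
  · intro K hKΩ hK α β q
    obtain ⟨c, hc, hc1, hcK⟩ := exists_pos_le_norm_snd hKΩ hK
    have hK' : IsCompact (Prod.fst '' K) := hK.image continuous_fst
    have hKΩ' : Prod.fst '' K ⊆ Ω := by
      rintro _ ⟨z, hz, rfl⟩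
      exact (hKΩ hz).1
    obtain ⟨N₁, h₁⟩ := hφ.2.1.eventually hKΩ' hK' α β
    obtain ⟨N₂, h₂⟩ := hω.2.1.eventually hKΩ' hK' α β
    set m := α.length + β.length with hm
    have h₃ := hdiff.eventually hKΩ' hK' α β (q + (N₁ + N₂) * m)
    obtain ⟨η, hη, hall⟩ := mem_nhdsGT_iff_exists_Ioc_subset.1 (h₁.and (h₂.and h₃))
    refine ⟨(2 ^ (m + 1) * c⁻¹ ^ m) ^ m * c⁻¹ ^ m, by positivity, min η 1,
      ⟨lt_min hη one_pos, min_le_right _ _⟩, fun ε hε z hz t ht => ?_⟩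
    obtain ⟨g₁, g₂, g₃⟩ := hall ⟨hε.1, hε.2.trans (min_le_left _ _)⟩
    have hε1 : ε ≤ 1 := hε.2.trans (min_le_right _ _)
    have hε0 : 0 < ε := hε.1
    have hi : 1 ≤ ε⁻¹ := (one_le_inv₀ hε0).2 hε1
    have hξ : t • z.2 ≠ 0 := norm_pos_iff.1 (hc.trans_le (hcK z hz t ht))
    refine (norm_dirDs_cexp_I_sub_le hΩ (hφ.1 ε ⟨hε0, hε1⟩).1 (hω.1 ε ⟨hε0, hε1⟩).1
      (hKΩ hz).1 hc hc1 (hcK z hz t ht) α β (A := ε⁻¹ ^ (N₁ + N₂))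
      (B := ε ^ (q + (N₁ + N₂) * m)) (one_le_pow₀ hi) (by positivity)
      (fun α' β' hα hβ => (g₁ α' β' hα hβ _ ⟨z, hz, rfl⟩ _ hξ).trans ?_)
      (fun α' β' hα hβ => (g₂ α' β' hα hβ _ ⟨z, hz, rfl⟩ _ hξ).trans ?_)
      (fun α' β' hα hβ => g₃ α' β' hα hβ _ ⟨z, hz, rfl⟩ _ hξ)).trans_eq ?_
    · gcongr
      omega
    · gcongr
      omega
    · have he : (ε⁻¹ ^ (N₁ + N₂)) ^ m * ε ^ (q + (N₁ + N₂) * m) = ε ^ q := by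
        rw [← pow_mul, inv_pow, pow_add]
        field_simp
      calc _ = (2 ^ (m + 1) * c⁻¹ ^ m) ^ m * c⁻¹ ^ m *
            ((ε⁻¹ ^ (N₁ + N₂)) ^ m * ε ^ (q + (N₁ + N₂) * m)) := by
            rw [← hm]; simp only [mul_pow]; ring
        _ = _ := by rw [he]
end
end

section
/- Let f ∈ C_c^∞(ℝ). (a) For every ε ∈ (0,1] and every x ∈ ℝ, (2π)^{−1} ∫_ℝ (∫_ℝ e^{i(x−εy)ξ} f(y) dy) dξ = ε^{−1} f(x/ε), the outer integral being absolutely convergent. (b) The net u_ε(x) := ε^{−1} f(x/ε) belongs to E_M(ℝ); if f is not identically zero, then for every negligible net (n_ε)_ε ∈ N(ℝ) the net (u_ε + n_ε)_ε does not belong to E^∞_M(ℝ). In particular the Colombeau class of (u_ε)_ε lies in G(ℝ) but not in G^∞(ℝ). -/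
open MeasureTheory Set
open scoped BigOperators Topology Real

noncomputable section

/-- Moderate nets of smooth functions on ℝ. -/
def EM1 (u : ℝ → ℝ → ℂ) : Prop :=
  (∀ ε ∈ Set.Ioc (0:ℝ) 1, ContDiff ℝ (⊤ : ℕ∞) (u ε)) ∧
  ∀ K : Set ℝ, IsCompact K → ∀ k : ℕ,
    ∃ N : ℕ, ∃ C > 0, ∃ η ∈ Set.Ioc (0:ℝ) 1, ∀ ε ∈ Set.Ioc (0:ℝ) η, ∀ x ∈ K,
      ‖deriv^[k] (u ε) x‖ ≤ C * ε ^ (-(N : ℤ))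

/-- Regular nets of smooth functions on ℝ. -/
def EMinf1 (u : ℝ → ℝ → ℂ) : Prop :=
  (∀ ε ∈ Set.Ioc (0:ℝ) 1, ContDiff ℝ (⊤ : ℕ∞) (u ε)) ∧
  ∀ K : Set ℝ, IsCompact K → ∃ N : ℕ, ∀ k : ℕ,
    ∃ C > 0, ∃ η ∈ Set.Ioc (0:ℝ) 1, ∀ ε ∈ Set.Ioc (0:ℝ) η, ∀ x ∈ K,
      ‖deriv^[k] (u ε) x‖ ≤ C * ε ^ (-(N : ℤ))

/-- Negligible nets of smooth functions on ℝ. -/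
def Neg1 (u : ℝ → ℝ → ℂ) : Prop :=
  (∀ ε ∈ Set.Ioc (0:ℝ) 1, ContDiff ℝ (⊤ : ℕ∞) (u ε)) ∧
  ∀ K : Set ℝ, IsCompact K → ∀ k q : ℕ,
    ∃ C > 0, ∃ η ∈ Set.Ioc (0:ℝ) 1, ∀ ε ∈ Set.Ioc (0:ℝ) η, ∀ x ∈ K,
      ‖deriv^[k] (u ε) x‖ ≤ C * ε ^ q

open FourierTransform in
/-- Fourier inversion with the angular-frequency normalisation, for the phase `(x - ε y) ξ`. -/
theorem fourier_inversion_rescaled {f : ℝ → ℂ} (hf : ContDiff ℝ (⊤ : ℕ∞) f)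
    (hfc : HasCompactSupport f) {ε : ℝ} (hε : 0 < ε) (x : ℝ) :
    Integrable (fun ξ : ℝ =>
      ∫ y : ℝ, Complex.exp (Complex.I * (((x - ε * y) * ξ : ℝ) : ℂ)) * f y) ∧
    (2 * Real.pi : ℝ)⁻¹ *
      (∫ ξ : ℝ, ∫ y : ℝ, Complex.exp (Complex.I * (((x - ε * y) * ξ : ℝ) : ℂ)) * f y) =
      (ε⁻¹ : ℝ) * f (x / ε) := by
  have hF : Integrable (𝓕 f) := by
    have h := (𝓕 (hfc.toSchwartzMap hf)).integrable (μ := volume)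
    rwa [SchwartzMap.fourier_coe] at h
  have hfi : Integrable f := hf.continuous.integrable_of_hasCompactSupport hfc
  set g : ℝ → ℂ := fun w => Complex.exp (((2 * π * (w * (x / ε)) : ℝ) : ℂ) * Complex.I) * 𝓕 f w
    with hg
  have hgi : Integrable g := by
    refine hF.bdd_mul (c := 1) (by fun_prop) (.of_forall fun w => ?_)
    rw [Complex.norm_exp_ofReal_mul_I]
  have hinv : ∫ w, g w = f (x / ε) := by
    rw [← congrFun (hf.continuous.fourierInv_fourier_eq hfi hF) (x / ε), Real.fourierInv_eq']
    simp [hg, mul_comm, mul_left_comm]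
  have hinner : (fun ξ : ℝ =>
      ∫ y : ℝ, Complex.exp (Complex.I * (((x - ε * y) * ξ : ℝ) : ℂ)) * f y) =
      fun ξ => g (ε / (2 * π) * ξ) := by
    funext ξ
    rw [hg]
    simp only
    rw [Real.fourier_real_eq_integral_exp_smul, ← integral_const_mul]
    congr 1 with y
    rw [smul_eq_mul, ← mul_assoc, ← Complex.exp_add, ← add_mul, ← Complex.ofReal_add,
      mul_comm Complex.I]
    congr 5
    field_simp
    ring
  rw [hinner]
  refine ⟨hgi.comp_mul_left' (by positivity), ?_⟩
  rw [Measure.integral_comp_mul_left, hinv, abs_of_pos (by positivity), Complex.real_smul,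
    ← mul_assoc, ← Complex.ofReal_mul]
  congr 2
  field_simp

theorem deriv_iterate_rescale {f : ℝ → ℂ} (hf : ContDiff ℝ (⊤ : ℕ∞) f) (ε : ℝ) (k : ℕ) (x : ℝ) :
    deriv^[k] (fun x => ((ε⁻¹ : ℝ) : ℂ) * f (x / ε)) x =
      ((ε⁻¹ ^ (k + 1) : ℝ) : ℂ) * deriv^[k] f (x / ε) := by
  have hk : ContDiff ℝ k f := hf.of_le (by exact_mod_cast le_top)
  have hcomp : ContDiff ℝ k fun x => f (ε⁻¹ * x) := by fun_prop
  simp only [div_eq_inv_mul, ← iteratedDeriv_eq_iterate]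
  rw [iteratedDeriv_const_mul _ hcomp.contDiffAt, iteratedDeriv_comp_const_smul hk]
  dsimp only
  rw [Complex.real_smul, ← mul_assoc, ← Complex.ofReal_mul, pow_succ']

theorem HasCompactSupport.deriv_iterate {f : ℝ → ℂ} (hfc : HasCompactSupport f) (k : ℕ) :
    HasCompactSupport (deriv^[k] f) := by
  induction k with
  | zero => exact hfc
  | succ k ih => rw [Function.iterate_succ_apply']; exact ih.deriv

theorem tsupport_deriv_iterate_subset (f : ℝ → ℂ) (k : ℕ) :
    tsupport (deriv^[k] f) ⊆ tsupport f := by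
  induction k with
  | zero => exact subset_rfl
  | succ k ih => rw [Function.iterate_succ_apply']; exact tsupport_deriv_subset.trans ih

/-- A nonzero compactly supported smooth function on `ℝ` has no iterated derivative that vanishes identically. -/
theorem deriv_iterate_ne_zero {f : ℝ → ℂ} (hf : ContDiff ℝ (⊤ : ℕ∞) f)
    (hfc : HasCompactSupport f) (h0 : f ≠ 0) (k : ℕ) : deriv^[k] f ≠ 0 := by
  induction k with
  | zero => exact h0
  | succ k ih =>
    intro h
    rw [Function.iterate_succ_apply'] at h
    have hconst := is_const_of_deriv_eq_zero
      ((hf.iterate_deriv k).differentiable (by simp)) (congrFun h)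
    obtain ⟨z, hz⟩ : ∃ z, deriv^[k] f z = 0 := by
      by_contra! hne
      have huniv : tsupport (deriv^[k] f) = univ :=
        eq_univ_of_forall fun z => subset_tsupport _ (hne z)
      have := (hfc.deriv_iterate k).isCompact
      rw [huniv] at this
      exact noncompact_univ ℝ this
    exact ih (funext fun x => (hconst x z).trans hz)

theorem contDiff_rescale {f : ℝ → ℂ} (hf : ContDiff ℝ (⊤ : ℕ∞) f) (ε : ℝ) :
    ContDiff ℝ (⊤ : ℕ∞) (fun x => ((ε⁻¹ : ℝ) : ℂ) * f (x / ε)) := by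
  fun_prop

theorem EM1_rescale {f : ℝ → ℂ} (hf : ContDiff ℝ (⊤ : ℕ∞) f) (hfc : HasCompactSupport f) :
    EM1 (fun ε x => ((ε⁻¹ : ℝ) : ℂ) * f (x / ε)) := by
  refine ⟨fun ε _ => contDiff_rescale hf ε, fun K _ k => ?_⟩
  obtain ⟨C, hC⟩ :=
    (hf.iterate_deriv k).continuous.bounded_above_of_compact_support (hfc.deriv_iterate k)
  refine ⟨k + 1, max C 1, by positivity, 1, by simp, fun ε hε x _ => ?_⟩
  have hε0 : 0 < ε := hε.1
  rw [deriv_iterate_rescale hf, norm_mul, Complex.norm_real, Real.norm_of_nonneg (by positivity),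
    mul_comm, zpow_neg, zpow_natCast, inv_pow]
  gcongr
  exact (hC _).trans (le_max_left _ _)

theorem not_EMinf1_rescale_add {f : ℝ → ℂ} (hf : ContDiff ℝ (⊤ : ℕ∞) f)
    (hfc : HasCompactSupport f) (h0 : f ≠ 0) {n : ℝ → ℝ → ℂ} (hn : Neg1 n) :
    ¬ EMinf1 (fun ε x => ((ε⁻¹ : ℝ) : ℂ) * f (x / ε) + n ε x) := by
  rintro ⟨-, hreg⟩
  obtain ⟨R, hR⟩ := hfc.isCompact.isBounded.subset_closedBall 0
  have hK : IsCompact (Metric.closedBall (0 : ℝ) R) := isCompact_closedBall _ _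
  obtain ⟨N, hN⟩ := hreg _ hK
  obtain ⟨C, hC, η, hη, hu⟩ := hN N
  obtain ⟨C', hC', η', hη', hv⟩ := hn.2 _ hK N 0
  obtain ⟨z, hz⟩ := Function.ne_iff.1 (deriv_iterate_ne_zero hf hfc h0 N)
  have hzR : ‖z‖ ≤ R := by
    simpa using hR (tsupport_deriv_iterate_subset f N (subset_tsupport _ hz))
  set c := ‖deriv^[N] f z‖
  have hc0 : 0 < c := norm_pos_iff.2 hz
  set ε := min (min η η') (c / (2 * (C + C')))
  have hε0 : 0 < ε := lt_min (lt_min hη.1 hη'.1) (by positivity)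
  have hεη : ε ≤ η := (min_le_left _ _).trans (min_le_left _ _)
  have hεη' : ε ≤ η' := (min_le_left _ _).trans (min_le_right _ _)
  have hε1 : ε ≤ 1 := hεη.trans hη.2
  have hεc : ε * (2 * (C + C')) ≤ c := (le_div_iff₀ (by positivity)).1 (min_le_right _ _)
  have hmem : ε * z ∈ Metric.closedBall (0 : ℝ) R := by
    rw [mem_closedBall_zero_iff, norm_mul, Real.norm_of_nonneg hε0.le]
    exact (mul_le_of_le_one_left (norm_nonneg z) hε1).trans hzR
  have hadd : deriv^[N] (fun x => ((ε⁻¹ : ℝ) : ℂ) * f (x / ε) + n ε x) (ε * z) =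
      ((ε⁻¹ ^ (N + 1) : ℝ) : ℂ) * deriv^[N] f z + deriv^[N] (n ε) (ε * z) := by
    have hle : (N : WithTop ℕ∞) ≤ ((⊤ : ℕ∞) : WithTop ℕ∞) := by exact_mod_cast le_top
    rw [← iteratedDeriv_eq_iterate, iteratedDeriv_fun_add
      ((contDiff_rescale hf ε).of_le hle).contDiffAt
      ((hn.1 ε ⟨hε0, hε1⟩).of_le hle).contDiffAt, iteratedDeriv_eq_iterate,
      iteratedDeriv_eq_iterate, deriv_iterate_rescale hf, mul_div_cancel_left₀ _ hε0.ne']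
  have hupper := hu ε ⟨hε0, hεη⟩ _ hmem
  have hneg := hv ε ⟨hε0, hεη'⟩ _ hmem
  rw [hadd, zpow_neg, zpow_natCast] at hupper
  rw [pow_zero, mul_one] at hneg
  have hlower : ε⁻¹ ^ (N + 1) * c ≤ C * (ε ^ N)⁻¹ + C' := by
    calc ε⁻¹ ^ (N + 1) * c = ‖((ε⁻¹ ^ (N + 1) : ℝ) : ℂ) * deriv^[N] f z‖ := by
          rw [norm_mul, Complex.norm_real, Real.norm_of_nonneg (by positivity)]
      _ ≤ _ := (norm_le_add_norm_add _ _).trans (add_le_add hupper hneg)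
  have hmul : c ≤ C * ε + C' * ε ^ (N + 1) := by
    have h := mul_le_mul_of_nonneg_left hlower (pow_nonneg hε0.le (N + 1))
    calc c = ε ^ (N + 1) * (ε⁻¹ ^ (N + 1) * c) := by
          rw [← mul_assoc, ← mul_pow, mul_inv_cancel₀ hε0.ne', one_pow, one_mul]
      _ ≤ _ := h
      _ = _ := by field_simp; ring
  have hpow : ε ^ (N + 1) ≤ ε := pow_le_of_le_one hε0.le hε1 N.succ_ne_zero
  nlinarith [mul_le_mul_of_nonneg_left hpow hC'.le, mul_pos hε0 (add_pos hC hC')]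

/-- Example: A with phase (x−εy)ξ maps into G(ℝ) but not into G^∞(ℝ):
(2π)⁻¹∫(∫ e^{i(x−εy)ξ}f(y)dy)dξ = ε⁻¹f(x/ε); the net (ε⁻¹f(·/ε))_ε is in E_M(ℝ) and,
for f ≠ 0, no negligible perturbation of it lies in E^∞_M(ℝ). -/
theorem stmt11 (f : ℝ → ℂ) (hf : ContDiff ℝ (⊤ : ℕ∞) f) (hfc : HasCompactSupport f) :
    (∀ ε ∈ Set.Ioc (0:ℝ) 1, ∀ x : ℝ,
      Integrable (fun ξ : ℝ =>
        ∫ y : ℝ, Complex.exp (Complex.I * (((x - ε * y) * ξ : ℝ) : ℂ)) * f y) ∧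
      (2 * Real.pi : ℝ)⁻¹ *
        (∫ ξ : ℝ, ∫ y : ℝ, Complex.exp (Complex.I * (((x - ε * y) * ξ : ℝ) : ℂ)) * f y) =
        (ε⁻¹ : ℝ) * f (x / ε)) ∧
    EM1 (fun ε x => (ε⁻¹ : ℝ) * f (x / ε)) ∧
    (f ≠ 0 → ∀ nn : ℝ → ℝ → ℂ, Neg1 nn →
      ¬ EMinf1 (fun ε x => (ε⁻¹ : ℝ) * f (x / ε) + nn ε x)) := by
  exact ⟨fun ε hε x => fourier_inversion_rescaled hf hfc hε.1 x, EM1_rescale hf hfc,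
    fun h0 _ hn => not_EMinf1_rescale_add hf hfc h0 hn⟩
end
end

section
/- Let (φ_ε)_{ε∈(0,1]} ∈ M_Φ(Ω×ℝ^p). Then |∇_ξφ|² is invertible on R_φ × (ℝ^p∖0): for every compact set K ⊆ R_φ there exist an open set O with K ⊆ O ⊆ Ω, constants c > 0, r ∈ ℝ and η ∈ (0,1] such that |∇_ξφ_ε(y,ξ)|² ≥ c ε^r for all y ∈ O, all ξ ∈ ℝ^p∖0 and all ε ≤ η. -/
open MeasureTheory Set
open scoped BigOperators Topology Real

noncomputable section

/-- Around a compact set of points at which `|∇_ξφ|²` is invertible there is an open set, conic in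
`ξ`, on which it is bounded below by a power of `ε`. -/
theorem IsCompact.exists_conic_rpow_le_gradXiSq {n p : ℕ} {Ω : Set (Euc n)}
    {φ : ℝ → Euc n × Euc p → ℝ} {A : Set (Euc n × Euc p)} (hA : IsCompact A)
    (hinv : ∀ z ∈ A, InvPt Ω φ z) :
    ∃ V : Set (Euc n × Euc p), IsOpen V ∧ A ⊆ V ∧
      (∀ z ∈ V, ∀ t : ℝ, 0 < t → (z.1, t • z.2) ∈ V) ∧
      ∃ r : ℝ, ∃ η ∈ Set.Ioc (0:ℝ) 1, ∀ ε ∈ Set.Ioc (0:ℝ) η, ∀ z ∈ V,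
        ε ^ r ≤ gradXiSq (φ ε) z := by
  refine hA.induction_on (p := fun B => ∃ V : Set (Euc n × Euc p), IsOpen V ∧ B ⊆ V ∧
      (∀ z ∈ V, ∀ t : ℝ, 0 < t → (z.1, t • z.2) ∈ V) ∧
      ∃ r : ℝ, ∃ η ∈ Set.Ioc (0:ℝ) 1, ∀ ε ∈ Set.Ioc (0:ℝ) η, ∀ z ∈ V,
        ε ^ r ≤ gradXiSq (φ ε) z) ?_ ?_ ?_ ?_
  · exact ⟨∅, isOpen_empty, subset_rfl, by simp, 0, 1, by simp, by simp⟩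
  · rintro B C hBC ⟨V, hV, hCV, h⟩
    exact ⟨V, hV, hBC.trans hCV, h⟩
  · rintro B C ⟨V, hV, hBV, hVc, r, η, hη, h⟩ ⟨W, hW, hCW, hWc, s, θ, hθ, h'⟩
    refine ⟨V ∪ W, hV.union hW, union_subset_union hBV hCW, ?_, max r s, min η θ,
      ⟨lt_min hη.1 hθ.1, (min_le_left _ _).trans hη.2⟩, ?_⟩
    · rintro z (hz | hz) t ht
      exacts [Or.inl (hVc z hz t ht), Or.inr (hWc z hz t ht)]
    · intro ε hε z hz
      have hεη : ε ≤ η := hε.2.trans (min_le_left _ _)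
      have hεθ : ε ≤ θ := hε.2.trans (min_le_right _ _)
      have hε1 : ε ≤ 1 := hεη.trans hη.2
      rcases hz with hz | hz
      · exact (Real.rpow_le_rpow_of_exponent_ge hε.1 hε1 (le_max_left r s)).trans
          (h ε ⟨hε.1, hεη⟩ z hz)
      · exact (Real.rpow_le_rpow_of_exponent_ge hε.1 hε1 (le_max_right r s)).trans
          (h' ε ⟨hε.1, hεθ⟩ z hz)
  · intro z hz
    obtain ⟨U, hU, hzU, -, -, Γ, hΓ, hzΓ, hcone, r, η, hη, h⟩ := hinv z hz
    exact ⟨U ×ˢ Γ, mem_nhdsWithin_of_mem_nhds ((hU.prod hΓ).mem_nhds ⟨hzU, hzΓ⟩),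
      U ×ˢ Γ, hU.prod hΓ, subset_rfl, fun w hw t ht => ⟨hw.1, hcone _ hw.2 t ht⟩, r, η, hη,
      fun ε hε w hw => h ε hε w.1 hw.1 w.2 hw.2⟩

/-- Proposition: |∇_ξφ|² is invertible on R_φ × (ℝ^p∖0): for every compact
K ⊆ R_φ there are an open set O with K ⊆ O ⊆ Ω and c > 0, r ∈ ℝ, η ∈ (0,1] with
|∇_ξφ_ε(y,ξ)|² ≥ c ε^r for all y ∈ O, ξ ≠ 0, ε ≤ η. -/
theorem stmt12 {n p : ℕ} (Ω : Set (Euc n)) (hΩ : IsOpen Ω)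
    (φ : ℝ → Euc n × Euc p → ℝ) (hφ : MPhi Ω φ) :
    ∀ K ⊆ Rphi Ω φ, IsCompact K →
      ∃ O : Set (Euc n), IsOpen O ∧ K ⊆ O ∧ O ⊆ Ω ∧
      ∃ c > (0:ℝ), ∃ r : ℝ, ∃ η ∈ Set.Ioc (0:ℝ) 1, ∀ ε ∈ Set.Ioc (0:ℝ) η,
        ∀ y ∈ O, ∀ ξ : Euc p, ξ ≠ 0 →
          c * ε ^ r ≤ gradXiSq (φ ε) (y, ξ) := by
  intro K hK hKc
  obtain ⟨V, hV, hKV, hcone, r, η, hη, h⟩ :=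
    (hKc.prod (isCompact_sphere (0 : Euc p) 1)).exists_conic_rpow_le_gradXiSq
      (Ω := Ω) (φ := φ) fun z hz => by
        by_contra hinv
        exact (hK hz.1).2
          ⟨z, ⟨(hK hz.1).1, ne_zero_of_mem_unit_sphere ⟨z.2, hz.2⟩, hinv⟩, rfl⟩
  obtain ⟨u, v, hu, -, hKu, hSv, huv⟩ :=
    generalized_tube_lemma hKc (isCompact_sphere (0 : Euc p) 1) hV hKV
  refine ⟨u ∩ Ω, hu.inter hΩ, subset_inter hKu fun y hy => (hK hy).1, inter_subset_right,
    1, one_pos, r, η, hη, fun ε hε y hy ξ hξ => ?_⟩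
  have hunit : ‖ξ‖⁻¹ • ξ ∈ Metric.sphere (0 : Euc p) 1 := by
    simp [norm_smul, hξ]
  have hmem := hcone (y, ‖ξ‖⁻¹ • ξ) (huv ⟨hy.1, hSv hunit⟩) ‖ξ‖ (norm_pos_iff.2 hξ)
  rw [smul_inv_smul₀ (norm_ne_zero_iff.2 hξ)] at hmem
  simpa using h ε hε _ hmem
end
end
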